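/- The general (unbounded) verification problem for HCMTL* in the interval-based semantics is undecidable: there is no algorithm that, given a timed automaton A and an HCMTL* sentence φ, decides whether {}, 0, ε ⊨_A φ. Moreover, undecidability already holds when φ is restricted to the HyperMITL fragment of HCMTL*. -/

import Mathlib

namespace HyTime

/-! ### Comparisons and clock constraints -/

/-- Comparison operators `<, ≤, =, ≥, >` used in clock constraints. -/
inductive Cmp where
  | lt | le | eq | ge | gt
  deriving DecidableEq

def Cmp.denote : Cmp → ℝ → ℝ → Prop
  | .lt => fun a b => a < b
  | .le => fun a b => a ≤ b
  | .eq => fun a b => a = b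
  | .ge => fun a b => b ≤ a
  | .gt => fun a b => b < a

def Cmp.code : Cmp → ℕ
  | .lt => 0
  | .le => 1
  | .eq => 2
  | .ge => 3
  | .gt => 4

/-- Clock constraints over one clock: positive boolean combinations of atoms `x ∼ c`,
where the constants `c` come from `α` (naturals, or rationals). -/
inductive ClkC (α : Type) where
  | atom : Cmp → α → ClkC α
  | disj : ClkC α → ClkC α → ClkC α
  | conj : ClkC α → ClkC α → ClkC α
  deriving DecidableEq

namespace ClkC
variable {α β : Type}

/-- Satisfaction of a clock constraint by a clock value `v : ℝ`;
`toR` interprets the constants as reals. -/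
def holds (toR : α → ℝ) (v : ℝ) : ClkC α → Prop
  | .atom c k => c.denote v (toR k)
  | .disj a b => a.holds toR v ∨ b.holds toR v
  | .conj a b => a.holds toR v ∧ b.holds toR v

/-- A missing constraint (`none`) is the trivial constraint. -/
def holdsOpt (toR : α → ℝ) (v : ℝ) : Option (ClkC α) → Prop
  | none => True
  | some c => c.holds toR v

def map (f : α → β) : ClkC α → ClkC β
  | .atom c k => .atom c (f k)
  | .disj a b => .disj (a.map f) (b.map f)
  | .conj a b => .conj (a.map f) (b.map f)

/-- The list of constants appearing in a clock constraint. -/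
def consts : ClkC α → List α
  | .atom _ k => [k]
  | .disj a b => a.consts ++ b.consts
  | .conj a b => a.consts ++ b.consts

end ClkC

/-- The canonical interpretation of natural-number constants as reals. -/
def natR : ℕ → ℝ := fun n => (n : ℝ)

/-- The canonical interpretation of rational constants as reals. -/
def ratR : ℚ → ℝ := fun q => (q : ℝ)

/-! ### Intervals of reals -/

/-- A bounded real interval, with open/closed information at both endpoints. -/
structure TIvl where
  lo : ℝ
  hi : ℝ
  loC : Bool
  hiC : Bool
  deriving Inhabited

namespace TIvl

/-- Membership of a time point in an interval. -/
def Mem (t : ℝ) (I : TIvl) : Prop :=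
  (if I.loC then I.lo ≤ t else I.lo < t) ∧ (if I.hiC then t ≤ I.hi else t < I.hi)

/-- A well-formed (nonempty) interval: either nondegenerate, or a closed singular interval. -/
def WF (I : TIvl) : Prop :=
  I.lo < I.hi ∨ (I.lo = I.hi ∧ I.loC = true ∧ I.hiC = true)

/-- Two intervals are consecutive: they share the endpoint `R(I) = L(J)`,
which belongs to exactly one of them (hence they are disjoint). -/
def Consecutive (I J : TIvl) : Prop := I.hi = J.lo ∧ I.hiC = !J.loC

end TIvl

/-! ### Timed automata (interval-based) -/

/-- An edge of an interval-based timed automaton: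
source, destination, guard (a set of constraints, each over a designated clock), reset set. -/
abbrev IEdge (α : Type) := ℕ × ℕ × List (ℕ × ClkC α) × List ℕ

/-- A timed automaton `A = (V, V₀, α, X, β, E, V_F)` over atomic propositions `props`.
States, propositions and clocks are natural numbers; all components are finite (lists).
`label` is the state labeling, `beta` assigns to (state, clock) pairs a clock constraint. -/
structure TA (α : Type) where
  states : List ℕ
  init : List ℕ
  props : List ℕ
  clocks : List ℕ
  label : List (ℕ × List ℕ)
  beta : List ((ℕ × ℕ) × ClkC α)
  edges : List (IEdge α)
  final : List ℕ

namespace TA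
variable {α β : Type}

def labelOf (A : TA α) (v : ℕ) : List ℕ := (A.label.lookup v).getD []

def betaOf (A : TA α) (v x : ℕ) : Option (ClkC α) :=
  (A.beta.find? (fun q => q.1.1 == v && q.1.2 == x)).map (·.2)

/-- All constants appearing in the constraints of a timed automaton. -/
def consts (A : TA α) : List α :=
  (A.beta.map (·.2)).flatMap ClkC.consts ++
    A.edges.flatMap (fun e => (e.2.2.1.map (·.2)).flatMap ClkC.consts)

/-- Apply a function to every constant of the automaton. -/
def map (f : α → β) (A : TA α) : TA β where
  states := A.states
  init := A.init
  props := A.props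
  clocks := A.clocks
  label := A.label
  beta := A.beta.map (fun q => (q.1, q.2.map f))
  edges := A.edges.map (fun e => (e.1, e.2.1, e.2.2.1.map (fun p => (p.1, p.2.map f)), e.2.2.2))
  final := A.final

end TA

/-! ### Executions of timed automata -/

/-- The raw data of an execution `(v₁,I₁) →^{γ₁}_{Ψ₁} ⋯ →^{γ_{n-1}}_{Ψ_{n-1}} (vₙ,Iₙ)`. -/
structure RawExec (α : Type) where
  states : List ℕ
  ivls : List TIvl
  guards : List (List (ℕ × ClkC α))
  resets : List (List ℕ)
  deriving Inhabited

namespace RawExec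
variable {α : Type}

def n (ρ : RawExec α) : ℕ := ρ.states.length
def ivl (ρ : RawExec α) (i : ℕ) : TIvl := ρ.ivls.getD i default
def state (ρ : RawExec α) (i : ℕ) : ℕ := ρ.states.getD i 0
def reset (ρ : RawExec α) (i : ℕ) : List ℕ := ρ.resets.getD i []
def guard (ρ : RawExec α) (i : ℕ) : List (ℕ × ClkC α) := ρ.guards.getD i []

/-- The `i`-th edge taken by the execution. -/
def edge (ρ : RawExec α) (i : ℕ) : IEdge α := (ρ.state i, ρ.state (i+1), ρ.guard i, ρ.reset i)

/-- The clock valuation `μ_{i+1}` when entering the `(i+1)`-st state: clocks start at `0`,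
advance with elapsed time, and the clocks reset at a transition are set to `0`. -/
def mu (ρ : RawExec α) : ℕ → ℕ → ℝ
  | 0, _ => 0
  | i+1, x => if x ∈ ρ.reset i then 0 else ρ.mu i x + ((ρ.ivl i).hi - (ρ.ivl i).lo)

/-- `t ∈ len(ρ)`. -/
def MemLen (t : ℝ) (ρ : RawExec α) : Prop := ∃ i, i < ρ.n ∧ TIvl.Mem t (ρ.ivl i)

/-- `ρ(t) = v`: at time `t` the execution is at state `v`. -/
def StateAt (ρ : RawExec α) (t : ℝ) (v : ℕ) : Prop :=
  ∃ i, i < ρ.n ∧ TIvl.Mem t (ρ.ivl i) ∧ ρ.state i = v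

/-- `ρ` is an execution of `A`: consistent lengths, an interval sequence starting at `0`,
an initial state, edges of `A`, state constraints throughout each interval, and
guard constraints at the transition times. -/
def IsExec (toR : α → ℝ) (A : TA α) (ρ : RawExec α) : Prop :=
  0 < ρ.n ∧ ρ.ivls.length = ρ.n ∧ ρ.guards.length = ρ.n - 1 ∧ ρ.resets.length = ρ.n - 1 ∧
  (ρ.ivl 0).lo = 0 ∧ (ρ.ivl 0).loC = true ∧
  (∀ i, i < ρ.n → (ρ.ivl i).WF) ∧
  (∀ i, i + 1 < ρ.n → (ρ.ivl i).Consecutive (ρ.ivl (i+1))) ∧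
  ρ.state 0 ∈ A.init ∧
  (∀ i, i + 1 < ρ.n → ρ.edge i ∈ A.edges) ∧
  (∀ i, i < ρ.n → ∀ x ∈ A.clocks, ∀ t : ℝ, TIvl.Mem t (ρ.ivl i) →
    ClkC.holdsOpt toR (ρ.mu i x + t - (ρ.ivl i).lo) (A.betaOf (ρ.state i) x)) ∧
  (∀ i, i + 1 < ρ.n → ∀ q ∈ ρ.guard i,
    ClkC.holds toR (ρ.mu i q.1 + (ρ.ivl i).hi - (ρ.ivl i).lo) q.2)

/-- An accepting execution: ends in a final state. -/
def IsAccExec (toR : α → ℝ) (A : TA α) (ρ : RawExec α) : Prop :=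
  ρ.IsExec toR A ∧ ρ.state (ρ.n - 1) ∈ A.final

/-- The execution is bounded by `N`: no time point `≥ N` belongs to it. -/
def BoundedBy (ρ : RawExec α) (N : ℝ) : Prop := ∀ t : ℝ, N ≤ t → ¬ MemLen t ρ

/-- Membership in `Exec(A)` (if `bd = none`) resp. `Exec_N(A)` (if `bd = some N`). -/
def InSem (toR : α → ℝ) (A : TA α) (bd : Option ℝ) (ρ : RawExec α) : Prop :=
  ρ.IsAccExec toR A ∧ ∀ N, bd = some N → ρ.BoundedBy N

/-- Index of the interval containing `t`. -/
noncomputable def idxAt (ρ : RawExec α) (t : ℝ) : ℕ :=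
  ρ.ivls.findIdx (fun I => @decide (TIvl.Mem t I) (Classical.propDecidable _))

/-- The prefix `ρ|_t` of an execution up to time `t`:
the last interval is intersected with `[0, t]`. -/
noncomputable def prefixUpTo (ρ : RawExec α) (t : ℝ) : RawExec α :=
  let i := ρ.idxAt t
  ⟨ρ.states.take (i + 1),
   ρ.ivls.take i ++ [⟨(ρ.ivl i).lo, t, (ρ.ivl i).loC, true⟩],
   ρ.guards.take i, ρ.resets.take i⟩

/-- Two executions are equal up to time `t` if their prefixes up to `t` are identical. -/
def EqUpTo (ρ₁ ρ₂ : RawExec α) (t : ℝ) : Prop := ρ₁.prefixUpTo t = ρ₂.prefixUpTo t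

end RawExec

/-! ### HCMTL* syntax -/

/-- An interval annotating a temporal operator: endpoints from `α`, with `hi = none`
denoting `∞`. -/
structure FIvl (α : Type) where
  lo : α
  hi : Option α
  loC : Bool
  hiC : Bool

namespace FIvl
variable {α β : Type}

/-- `t ∈ base + I`. -/
def Mem (toR : α → ℝ) (base t : ℝ) (I : FIvl α) : Prop :=
  (if I.loC then base + toR I.lo ≤ t else base + toR I.lo < t) ∧
  (∀ h, I.hi = some h → (if I.hiC then t ≤ base + toR h else t < base + toR h))

/-- A singular interval `[c, c]`. -/
def Singular (I : FIvl α) : Prop := I.loC = true ∧ I.hiC = true ∧ I.hi = some I.lo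

def map (f : α → β) (I : FIvl α) : FIvl β := ⟨f I.lo, I.hi.map f, I.loC, I.hiC⟩

def consts (I : FIvl α) : List α := I.lo :: I.hi.toList

end FIvl

/-- HCMTL* formulas in negation normal form:
`φ ::= p_π | ¬p_π | φ ∨ φ | φ ∧ φ | F_I φ | G_I φ | φ U_I φ | ∃π φ | ∀π φ`.
Propositions and path variables are natural numbers; interval endpoints come from `α`. -/
inductive HF (α : Type) where
  | pos : ℕ → ℕ → HF α
  | neg : ℕ → ℕ → HF α
  | disj : HF α → HF α → HF α
  | conj : HF α → HF α → HF α
  | fut : FIvl α → HF α → HF α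
  | glob : FIvl α → HF α → HF α
  | untl : FIvl α → HF α → HF α → HF α
  | ex : ℕ → HF α → HF α
  | all : ℕ → HF α → HF α

namespace HF
variable {α β : Type}

/-- Free path variables. -/
def free : HF α → Finset ℕ
  | .pos _ π => {π}
  | .neg _ π => {π}
  | .disj a b => a.free ∪ b.free
  | .conj a b => a.free ∪ b.free
  | .fut _ a => a.free
  | .glob _ a => a.free
  | .untl _ a b => a.free ∪ b.free
  | .ex π a => a.free.erase π
  | .all π a => a.free.erase π

/-- A sentence has no free path variables. -/
def Sentence (φ : HF α) : Prop := φ.free = ∅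

/-- Quantifier-free formulas. -/
def QFree : HF α → Prop
  | .pos _ _ => True
  | .neg _ _ => True
  | .disj a b => a.QFree ∧ b.QFree
  | .conj a b => a.QFree ∧ b.QFree
  | .fut _ a => a.QFree
  | .glob _ a => a.QFree
  | .untl _ a b => a.QFree ∧ b.QFree
  | .ex _ _ => False
  | .all _ _ => False

/-- All intervals occurring in the formula are non-singular. -/
def NonSing : HF α → Prop
  | .pos _ _ => True
  | .neg _ _ => True
  | .disj a b => a.NonSing ∧ b.NonSing
  | .conj a b => a.NonSing ∧ b.NonSing
  | .fut I a => ¬ I.Singular ∧ a.NonSing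
  | .glob I a => ¬ I.Singular ∧ a.NonSing
  | .untl I a b => ¬ I.Singular ∧ a.NonSing ∧ b.NonSing
  | .ex _ a => a.NonSing
  | .all _ a => a.NonSing

/-- The HyperMITL fragment: all quantifiers at the top level, all intervals non-singular. -/
def HyperMITL : HF α → Prop
  | .ex _ a => a.HyperMITL
  | .all _ a => a.HyperMITL
  | φ => φ.QFree ∧ φ.NonSing

/-- Apply a function to every interval endpoint of the formula. -/
def map (f : α → β) : HF α → HF β
  | .pos p π => .pos p π
  | .neg p π => .neg p π
  | .disj a b => .disj (a.map f) (b.map f)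
  | .conj a b => .conj (a.map f) (b.map f)
  | .fut I a => .fut (I.map f) (a.map f)
  | .glob I a => .glob (I.map f) (a.map f)
  | .untl I a b => .untl (I.map f) (a.map f) (b.map f)
  | .ex π a => .ex π (a.map f)
  | .all π a => .all π (a.map f)

/-- The list of interval endpoints appearing in the formula. -/
def consts : HF α → List α
  | .pos _ _ => []
  | .neg _ _ => []
  | .disj a b => a.consts ++ b.consts
  | .conj a b => a.consts ++ b.consts
  | .fut I a => I.consts ++ a.consts
  | .glob I a => I.consts ++ a.consts
  | .untl I a b => I.consts ++ a.consts ++ b.consts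
  | .ex _ a => a.consts
  | .all _ a => a.consts

end HF

/-! ### HCMTL* interval-based semantics -/

/-- Time bound restriction: with `bd = some N`, only times `< N` are considered. -/
def inBd : Option ℝ → ℝ → Prop
  | none, _ => True
  | some N, t => t < N

/-- The interval-based satisfaction relation `Π, t, † ⊨_A φ` (with `bd = none`),
resp. its time-bounded variant `Π, t, † ⊨^N_A φ` (with `bd = some N`).
`d = none` represents `† = ε`, and `d = some π` represents `† = π`. -/
def HSat {α : Type} (toR : α → ℝ) (A : TA α) (bd : Option ℝ) :
    HF α → (ℕ → RawExec α) → ℝ → Option ℕ → Prop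
  | .pos p π, Env, t, _ =>
      RawExec.MemLen t (Env π) ∧ ∃ v, RawExec.StateAt (Env π) t v ∧ p ∈ A.labelOf v
  | .neg p π, Env, t, _ =>
      RawExec.MemLen t (Env π) ∧ ∃ v, RawExec.StateAt (Env π) t v ∧ p ∉ A.labelOf v
  | .disj a b, Env, t, d => HSat toR A bd a Env t d ∨ HSat toR A bd b Env t d
  | .conj a b, Env, t, d => HSat toR A bd a Env t d ∧ HSat toR A bd b Env t d
  | .fut I a, Env, t, d => ∃ t', t < t' ∧ inBd bd t' ∧ FIvl.Mem toR t t' I ∧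
      HSat toR A bd a Env t' d
  | .glob I a, Env, t, d => ∀ t', t < t' → inBd bd t' → FIvl.Mem toR t t' I →
      HSat toR A bd a Env t' d
  | .untl I a b, Env, t, d => ∃ t', t < t' ∧ inBd bd t' ∧ FIvl.Mem toR t t' I ∧
      HSat toR A bd b Env t' d ∧ ∀ t'', t < t'' → t'' < t' → HSat toR A bd a Env t'' d
  | .ex π a, Env, t, d => ∃ ρ, RawExec.InSem toR A bd ρ ∧
      ((d = none ∧ t = 0) ∨
        ∃ d₀, d = some d₀ ∧ RawExec.MemLen t (Env d₀) ∧ RawExec.EqUpTo ρ (Env d₀) t) ∧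
      HSat toR A bd a (Function.update Env π ρ) t (some π)
  | .all π a, Env, t, d => ∀ ρ, RawExec.InSem toR A bd ρ →
      ((d = none ∧ t = 0) ∨
        ∃ d₀, d = some d₀ ∧ RawExec.MemLen t (Env d₀) ∧ RawExec.EqUpTo ρ (Env d₀) t) →
      HSat toR A bd a (Function.update Env π ρ) t (some π)

/-! ### MSO(<, +1) -/

/-- MSO(<,+1) formulas over monadic predicate names `σ` and first-order variables `ℕ`:
`φ ::= x < y | +1(x,y) | P(x) | φ ∨ φ | ¬φ | ∃x φ | ∃P φ`. -/
inductive MSO (σ : Type) where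
  | lt : ℕ → ℕ → MSO σ
  | succ : ℕ → ℕ → MSO σ
  | app : σ → ℕ → MSO σ
  | disj : MSO σ → MSO σ → MSO σ
  | neg : MSO σ → MSO σ
  | exFO : ℕ → MSO σ → MSO σ
  | exSO : σ → MSO σ → MSO σ

/-- Continuity of a flow at `t` (within the time domain `D`). -/
def ContAt {σ : Type} (D : Set ℝ) (f : ℝ → Set σ) (t : ℝ) : Prop :=
  ∃ ε : ℝ, 0 < ε ∧ ∀ s ∈ D, |s - t| < ε → f s = f t

/-- A flow is finitely variable: on every bounded interval it has only finitely many
discontinuities. -/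
def FinVar {σ : Type} (D : Set ℝ) (f : ℝ → Set σ) : Prop :=
  ∀ a b : ℝ, Set.Finite {t | t ∈ D ∩ Set.Icc a b ∧ ¬ ContAt D f t}

namespace MSO
variable {σ : Type}

/-- Satisfaction `f, I ⊨ φ` of an MSO(<,+1) formula over the time domain `D`,
by a flow `f` and a first-order interpretation `ivar`. Second-order quantification
ranges over finitely variable flows agreeing with `f` except at the quantified predicate. -/
def Sat (D : Set ℝ) : MSO σ → (ℝ → Set σ) → (ℕ → ℝ) → Prop
  | .lt x y, _, ivar => ivar x < ivar y
  | .succ x y, _, ivar => ivar y = ivar x + 1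
  | .app P x, f, ivar => P ∈ f (ivar x)
  | .disj a b, f, ivar => Sat D a f ivar ∨ Sat D b f ivar
  | .neg a, f, ivar => ¬ Sat D a f ivar
  | .exFO x a, f, ivar => ∃ r ∈ D, Sat D a f (Function.update ivar x r)
  | .exSO P a, f, ivar => ∃ g : ℝ → Set σ, FinVar D g ∧
      (∀ t ∈ D, ∀ Q, Q ≠ P → (Q ∈ g t ↔ Q ∈ f t)) ∧ Sat D a g ivar

/-- Free first-order variables. -/
def freeFO : MSO σ → Finset ℕ
  | .lt x y => {x, y}
  | .succ x y => {x, y}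
  | .app _ x => {x}
  | .disj a b => a.freeFO ∪ b.freeFO
  | .neg a => a.freeFO
  | .exFO x a => a.freeFO.erase x
  | .exSO _ a => a.freeFO

/-- Free monadic (second-order) predicates. -/
def freeSO [DecidableEq σ] : MSO σ → Finset σ
  | .lt _ _ => ∅
  | .succ _ _ => ∅
  | .app P _ => {P}
  | .disj a b => a.freeSO ∪ b.freeSO
  | .neg a => a.freeSO
  | .exFO _ a => a.freeSO
  | .exSO P a => a.freeSO.erase P

/-- Purely first-order formulas: no monadic predicates occur at all. -/
def FOonly : MSO σ → Prop
  | .lt _ _ => True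
  | .succ _ _ => True
  | .app _ _ => False
  | .disj a b => a.FOonly ∧ b.FOonly
  | .neg a => a.FOonly
  | .exFO _ a => a.FOonly
  | .exSO _ _ => False

end MSO

/-! ### The monadic predicates `MP = V ∪ T ∪ R` and the encoding ι of executions as flows -/

/-- The monadic predicates associated to a timed automaton: states `v`, transition markers
`T⁻_e`, `T⁺_e` for edges `e`, and reset markers `R⁰_x`, `R¹_x` for clocks `x`. -/
inductive MPred (α : Type) where
  | st : ℕ → MPred α
  | tminus : IEdge α → MPred α
  | tplus : IEdge α → MPred α
  | r0 : ℕ → MPred α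
  | r1 : ℕ → MPred α
  deriving DecidableEq

/-- The encoding `ι_A` of an execution as a flow over `MP = V ∪ T ∪ R`:
at each time, the current state; at a `T⁻` transition time `t = L(I_{i+1}) ∈ I_{i+1}`,
the marker `T⁻_e` and resets `R⁰_x` (for the clocks `x` reset by `e`);
at a `T⁺` transition time `t = R(I_i) ∈ I_i`, the marker `T⁺_e` and resets `R¹_x`;
and `∅` after the execution has ended. -/
def iota {α : Type} (ρ : RawExec α) (t : ℝ) : Set (MPred α) :=
  {mp | match mp with
    | .st v => RawExec.StateAt ρ t v
    | .tminus e => ∃ i, i + 1 < ρ.n ∧ ρ.edge i = e ∧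
        t = (ρ.ivl (i+1)).lo ∧ TIvl.Mem t (ρ.ivl (i+1))
    | .tplus e => ∃ i, i + 1 < ρ.n ∧ ρ.edge i = e ∧
        t = (ρ.ivl i).hi ∧ TIvl.Mem t (ρ.ivl i)
    | .r0 x => ∃ i, i + 1 < ρ.n ∧ x ∈ ρ.reset i ∧
        t = (ρ.ivl (i+1)).lo ∧ TIvl.Mem t (ρ.ivl (i+1))
    | .r1 x => ∃ i, i + 1 < ρ.n ∧ x ∈ ρ.reset i ∧
        t = (ρ.ivl i).hi ∧ TIvl.Mem t (ρ.ivl i)}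

/-- The combined flow `f_Π` of a path environment `Π` on path variables `1, …, m`,
over the pairwise disjoint indexed copies `MP_1 ∪ ⋯ ∪ MP_m` (tagged by the index). -/
def fPi (m : ℕ) (Env : ℕ → RawExec ℕ) : ℝ → Set (ℕ × MPred ℕ) :=
  fun t => {q | 1 ≤ q.1 ∧ q.1 ≤ m ∧ q.2 ∈ iota (Env q.1) t}

end HyTime

namespace HyTime

/-! ### Timed automata in the point-based semantics -/

/-- A transition of a point-based timed automaton: source state, event (a set of
propositions), guard, reset set, destination state. -/
abbrev PEdge (α : Type) := ℕ × List ℕ × List (ℕ × ClkC α) × List ℕ × ℕ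

def PEdge.src {α : Type} (e : PEdge α) : ℕ := e.1
def PEdge.event {α : Type} (e : PEdge α) : List ℕ := e.2.1
def PEdge.guard {α : Type} (e : PEdge α) : List (ℕ × ClkC α) := e.2.2.1
def PEdge.rst {α : Type} (e : PEdge α) : List ℕ := e.2.2.2.1
def PEdge.dst {α : Type} (e : PEdge α) : ℕ := e.2.2.2.2

/-- A timed automaton in the point-based semantics `B = (𝒫(P), S, s₀, X, Δ, F)`. -/
structure PTA (α : Type) where
  states : List ℕ
  start : ℕ
  props : List ℕ
  clocks : List ℕ
  trans : List (PEdge α)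
  final : List ℕ

/-- The raw data of a run `(s₀,μ₀) →^{e₁,t₁} ⋯ →^{eₙ,tₙ} (sₙ,μₙ)`:
the transitions taken and their times. -/
structure PRun (α : Type) where
  edges : List (PEdge α)
  times : List ℝ
  deriving Inhabited

namespace PRun
variable {α : Type}

def n (η : PRun α) : ℕ := η.edges.length
def edge (η : PRun α) (i : ℕ) : PEdge α := η.edges.getD i default
def time (η : PRun α) (i : ℕ) : ℝ := η.times.getD i 0
def tprev (η : PRun α) (i : ℕ) : ℝ := if i = 0 then 0 else η.time (i - 1)

/-- The clock valuation `μ_i` after `i` transitions. -/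
def mu (η : PRun α) : ℕ → ℕ → ℝ
  | 0, _ => 0
  | i+1, x => if x ∈ PEdge.rst (η.edge i) then 0 else η.mu i x + (η.time i - η.tprev i)

/-- `η` is a run of `B`: nonempty, increasing nonnegative transition times,
starting at the start state, consecutive transitions of `Δ`, guards holding at
transition times. -/
def IsRun (toR : α → ℝ) (B : PTA α) (η : PRun α) : Prop :=
  0 < η.n ∧ η.times.length = η.n ∧
  0 ≤ η.time 0 ∧ (∀ i, i + 1 < η.n → η.time i < η.time (i+1)) ∧
  PEdge.src (η.edge 0) = B.start ∧
  (∀ i, i < η.n → η.edge i ∈ B.trans) ∧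
  (∀ i, i + 1 < η.n → PEdge.src (η.edge (i+1)) = PEdge.dst (η.edge i)) ∧
  (∀ i, i < η.n → ∀ q ∈ PEdge.guard (η.edge i),
    ClkC.holds toR (η.mu i q.1 + (η.time i - η.tprev i)) q.2)

/-- An accepting run: ends in a final state. -/
def IsAccRun (toR : α → ℝ) (B : PTA α) (η : PRun α) : Prop :=
  η.IsRun toR B ∧ PEdge.dst (η.edge (η.n - 1)) ∈ B.final

/-- The duration `len(η) = tₙ` of a run. -/
def len (η : PRun α) : ℝ := η.time (η.n - 1)

/-- All transition times are `< N`. -/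
def BoundedBy (η : PRun α) (N : ℝ) : Prop := ∀ i, i < η.n → η.time i < N

/-- Membership in `Runs(B)` (if `bd = none`) resp. its bounded variant. -/
def InSem (toR : α → ℝ) (B : PTA α) (bd : Option ℝ) (η : PRun α) : Prop :=
  η.IsAccRun toR B ∧ ∀ N, bd = some N → η.BoundedBy N

/-- `t ∈ η`: `t` is one of the transition (event) times of `η`. -/
def EvtTime (η : PRun α) (t : ℝ) : Prop := ∃ i, i < η.n ∧ η.time i = t

/-- `η'` is an extension of `η` from time `t`: they agree on all transitions at
times `≤ t`, and all later transitions (of either run) occur after `t`. -/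
def ExtendsFrom (η' η : PRun α) (t : ℝ) : Prop :=
  ∃ i, i ≤ η.n ∧ i ≤ η'.n ∧
    η'.edges.take i = η.edges.take i ∧ η'.times.take i = η.times.take i ∧
    (∀ j, j < i → η.time j ≤ t) ∧
    (∀ j, i ≤ j → j < η.n → t < η.time j) ∧
    (∀ j, i ≤ j → j < η'.n → t < η'.time j)

end PRun

/-! ### HCMTL* point-based semantics -/

/-- The point-based satisfaction relation `Γ, t, † ⊨_B φ` (with `bd = none`),
resp. its time-bounded variant (with `bd = some N`). `V` is the current set of
path variables (the domain of the environment `Γ`); temporal operators range only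
over event points of the runs in `Γ`. -/
def PSat {α : Type} (toR : α → ℝ) (B : PTA α) (bd : Option ℝ) :
    HF α → Finset ℕ → (ℕ → PRun α) → ℝ → Option ℕ → Prop
  | .pos p π, _, Γ, t, _ =>
      ∃ i, i < (Γ π).n ∧ (Γ π).time i = t ∧ p ∈ PEdge.event ((Γ π).edge i)
  | .neg p π, _, Γ, t, _ =>
      ∃ i, i < (Γ π).n ∧ (Γ π).time i = t ∧ p ∉ PEdge.event ((Γ π).edge i)
  | .disj a b, V, Γ, t, d => PSat toR B bd a V Γ t d ∨ PSat toR B bd b V Γ t d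
  | .conj a b, V, Γ, t, d => PSat toR B bd a V Γ t d ∧ PSat toR B bd b V Γ t d
  | .fut I a, V, Γ, t, d => ∃ t', t < t' ∧ inBd bd t' ∧ FIvl.Mem toR t t' I ∧
      (∃ π ∈ V, PRun.EvtTime (Γ π) t') ∧ PSat toR B bd a V Γ t' d
  | .glob I a, V, Γ, t, d => ∀ t', t < t' → inBd bd t' → FIvl.Mem toR t t' I →
      (∃ π ∈ V, PRun.EvtTime (Γ π) t') → PSat toR B bd a V Γ t' d
  | .untl I a b, V, Γ, t, d => ∃ t', t < t' ∧ inBd bd t' ∧ FIvl.Mem toR t t' I ∧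
      (∃ π ∈ V, PRun.EvtTime (Γ π) t') ∧ PSat toR B bd b V Γ t' d ∧
      (∀ t'', t < t'' → t'' < t' → (∃ π ∈ V, PRun.EvtTime (Γ π) t'') →
        PSat toR B bd a V Γ t'' d)
  | .ex π a, V, Γ, t, d => ∃ η, PRun.InSem toR B bd η ∧
      ((d = none ∧ t = 0) ∨
        ∃ d₀, d = some d₀ ∧ t ≤ PRun.len (Γ d₀) ∧ PRun.ExtendsFrom η (Γ d₀) t) ∧
      PSat toR B bd a (insert π V) (Function.update Γ π η) t (some π)
  | .all π a, V, Γ, t, d => ∀ η, PRun.InSem toR B bd η →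
      ((d = none ∧ t = 0) ∨
        ∃ d₀, d = some d₀ ∧ t ≤ PRun.len (Γ d₀) ∧ PRun.ExtendsFrom η (Γ d₀) t) →
      PSat toR B bd a (insert π V) (Function.update Γ π η) t (some π)

/-! ### Concrete injective encodings of syntax into ℕ -/

def encList {α : Type} (f : α → ℕ) : List α → ℕ
  | [] => 0
  | a :: l => Nat.pair (f a) (encList f l) + 1

def encClkC : ClkC ℕ → ℕ
  | .atom c k => Nat.pair 0 (Nat.pair c.code k)
  | .disj a b => Nat.pair 1 (Nat.pair (encClkC a) (encClkC b))
  | .conj a b => Nat.pair 2 (Nat.pair (encClkC a) (encClkC b))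

def encGuard (g : List (ℕ × ClkC ℕ)) : ℕ := encList (fun q => Nat.pair q.1 (encClkC q.2)) g

def encIEdge (e : IEdge ℕ) : ℕ :=
  Nat.pair e.1 (Nat.pair e.2.1 (Nat.pair (encGuard e.2.2.1) (encList id e.2.2.2)))

/-- Injective encoding of timed automata as natural numbers. -/
def encTA (A : TA ℕ) : ℕ :=
  Nat.pair (encList id A.states) <| Nat.pair (encList id A.init) <|
  Nat.pair (encList id A.props) <| Nat.pair (encList id A.clocks) <|
  Nat.pair (encList (fun q => Nat.pair q.1 (encList id q.2)) A.label) <|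
  Nat.pair (encList (fun q => Nat.pair (Nat.pair q.1.1 q.1.2) (encClkC q.2)) A.beta) <|
  Nat.pair (encList encIEdge A.edges) (encList id A.final)

def encFIvl (I : FIvl ℕ) : ℕ :=
  Nat.pair I.lo <| Nat.pair (match I.hi with | none => 0 | some h => h + 1) <|
  Nat.pair I.loC.toNat I.hiC.toNat

/-- Injective encoding of HCMTL* formulas as natural numbers. -/
def encHF : HF ℕ → ℕ
  | .pos p π => Nat.pair 0 (Nat.pair p π)
  | .neg p π => Nat.pair 1 (Nat.pair p π)
  | .disj a b => Nat.pair 2 (Nat.pair (encHF a) (encHF b))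
  | .conj a b => Nat.pair 3 (Nat.pair (encHF a) (encHF b))
  | .fut I a => Nat.pair 4 (Nat.pair (encFIvl I) (encHF a))
  | .glob I a => Nat.pair 5 (Nat.pair (encFIvl I) (encHF a))
  | .untl I a b => Nat.pair 6 (Nat.pair (encFIvl I) (Nat.pair (encHF a) (encHF b)))
  | .ex π a => Nat.pair 7 (Nat.pair π (encHF a))
  | .all π a => Nat.pair 8 (Nat.pair π (encHF a))

def encPEdge (e : PEdge ℕ) : ℕ :=
  Nat.pair (PEdge.src e) <| Nat.pair (encList id (PEdge.event e)) <|
  Nat.pair (encGuard (PEdge.guard e)) <| Nat.pair (encList id (PEdge.rst e)) (PEdge.dst e)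

/-- Injective encoding of point-based timed automata as natural numbers. -/
def encPTA (B : PTA ℕ) : ℕ :=
  Nat.pair (encList id B.states) <| Nat.pair B.start <| Nat.pair (encList id B.props) <|
  Nat.pair (encList id B.clocks) <| Nat.pair (encList encPEdge B.trans) (encList id B.final)

/-- Injective encoding of MSO(<,+1) formulas as natural numbers. -/
def encMSO : MSO ℕ → ℕ
  | .lt x y => Nat.pair 0 (Nat.pair x y)
  | .succ x y => Nat.pair 1 (Nat.pair x y)
  | .app P x => Nat.pair 2 (Nat.pair P x)
  | .disj a b => Nat.pair 3 (Nat.pair (encMSO a) (encMSO b))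
  | .neg a => Nat.pair 4 (encMSO a)
  | .exFO x a => Nat.pair 5 (Nat.pair x (encMSO a))
  | .exSO P a => Nat.pair 6 (Nat.pair P (encMSO a))

/-! ### The interval-based automaton ⟦B⟧ associated to a point-based automaton B -/

/-- Code of an original state of `B` as a state of `⟦B⟧`. -/
def stCode (s : ℕ) : ℕ := 2 * s
/-- Code of a transition of `B` as a (transition-)state of `⟦B⟧`. -/
def edCode (e : PEdge ℕ) : ℕ := 2 * encPEdge e + 1
/-- The fresh proposition `#` marking transition-states. -/
def hashProp : ℕ := 0
/-- Code of an original proposition of `B` as a proposition of `⟦B⟧`. -/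
def propCode (p : ℕ) : ℕ := 2 * p + 1
/-- Code of a state of `B` as a proposition of `⟦B⟧` (over `P ∪ S ∪ {#}`). -/
def stPropCode (s : ℕ) : ℕ := 2 * s + 2
/-- Code of an original clock of `B` as a clock of `⟦B⟧`. -/
def clkCode (x : ℕ) : ℕ := x + 1
/-- The fresh clock `x_sing` forcing transition-states to be singular. -/
def xsing : ℕ := 0

/-- The interval-based timed automaton `⟦B⟧` over `P ∪ S ∪ {#}`: its states are the
states of `B` together with the transitions of `B`; transition-states are labeled by
their event together with `#`, carry the guard constraints and the constraint
`x_sing = 0`; edges alternate between states and transition-states, resetting `x_sing`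
on entry to a transition-state and the transition's resets on exit. -/
def ibOf (B : PTA ℕ) : TA ℕ where
  states := B.states.map stCode ++ B.trans.map edCode
  init := stCode B.start :: (B.trans.filter (fun e => PEdge.src e == B.start)).map edCode
  props := hashProp :: (B.props.map propCode ++ B.states.map stPropCode)
  clocks := xsing :: B.clocks.map clkCode
  label := B.states.map (fun s => (stCode s, [stPropCode s])) ++
    B.trans.map (fun e => (edCode e, hashProp :: (PEdge.event e).map propCode))
  beta := B.trans.map (fun e => ((edCode e, xsing), ClkC.atom Cmp.eq 0)) ++
    B.trans.flatMap (fun e => B.clocks.filterMap (fun x =>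
      match (PEdge.guard e).filter (fun q => q.1 == x) with
      | [] => none
      | q :: rest =>
          some ((edCode e, clkCode x), rest.foldl (fun acc r => ClkC.conj acc r.2) q.2)))
  edges := B.trans.flatMap (fun e =>
    [(stCode (PEdge.src e), edCode e, [], [xsing]),
     (edCode e, stCode (PEdge.dst e), [], (PEdge.rst e).map clkCode)])
  final := (B.trans.filter (fun e => B.final.contains (PEdge.dst e))).map edCode

/-- The map `χ` sending a run `(s₀,μ₀) →^{e₁,t₁} ⋯ →^{eₙ,tₙ} (sₙ,μₙ)` of `B` to the
execution `(s₀,[0,t₁)), (e₁,[t₁,t₁]), (s₁,(t₁,t₂)), …, (eₙ,[tₙ,tₙ])` of `⟦B⟧`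
(starting at `(e₁,[0,0])` if `t₁ = 0`). -/
noncomputable def chi (η : PRun ℕ) : RawExec ℕ :=
  let n := η.n
  let sts := η.edges.flatMap (fun e => [stCode (PEdge.src e), edCode e])
  let ivls := (List.range n).flatMap (fun i =>
    [⟨η.tprev i, η.time i, decide (i = 0), false⟩, ⟨η.time i, η.time i, true, true⟩])
  let gds : List (List (ℕ × ClkC ℕ)) := List.replicate (2 * n - 1) []
  let rsts := ((List.range n).flatMap
    (fun i => [[xsing], (PEdge.rst (η.edge i)).map clkCode])).take (2 * n - 1)
  if η.time 0 = 0 then ⟨sts.tail, ivls.tail, gds.tail, rsts.tail⟩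
  else ⟨sts, ivls, gds, rsts⟩

end HyTime

namespace HyTime

/-! ### Stacks stored bottom-up in a row of cells -/

/-- The effect of a transition on one stack. -/
inductive Act (Γ : Type) where
  | keep | bot
  | push (γ : Γ) | pop (γ : Γ) | top (γ : Γ)

namespace Act
variable {Γ : Type}

/-- The relation between the stack before and the stack after (top first). -/
def rel : Act Γ → List Γ → List Γ → Prop
  | keep, s, s' => s' = s
  | bot, s, s' => s = [] ∧ s' = []
  | push γ, s, s' => s' = γ :: s
  | pop γ, s, s' => s = γ :: s'
  | top γ, s, s' => s' = s ∧ s.head? = some γ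

/-- The top of the old stack lies at the border of the neighbouring cells `p` and `c`.
A cell holds an old and a new entry; `none` is the boundary of the row. -/
def Cut (p c : Option (Option Γ × Option Γ)) : Prop :=
  (∀ x, p = some x → x.1 ≠ none) ∧ (∀ x, c = some x → x.1 = none)

/-- The local condition on neighbouring cells that characterises `rel`. -/
def loc : Act Γ → Option (Option Γ × Option Γ) → Option (Option Γ × Option Γ) → Prop
  | keep, _, c => ∀ x, c = some x → x.2 = x.1
  | bot, _, c => ∀ x, c = some x → x.1 = none ∧ x.2 = none
  | push γ, p, c => (Cut p c → c = some (none, some γ)) ∧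
      (¬ Cut p c → ∀ x, c = some x → x.2 = x.1)
  | pop γ, p, c => (Cut p c → p = some (some γ, none)) ∧
      (¬ Cut p c → ∀ x, p = some x → x.2 = x.1)
  | top γ, p, c => (Cut p c → p = some (some γ, some γ)) ∧
      (¬ Cut p c → ∀ x, p = some x → x.2 = x.1)

/-- The cells of a row of width `N`, numbered from `1`, with boundaries outside. -/
def cells (N : ℕ) (x y : ℕ → Option Γ) (r : ℕ) : Option (Option Γ × Option Γ) :=
  if 0 < r ∧ r ≤ N then some (x (r - 1), y (r - 1)) else none

variable {N : ℕ} {x y : ℕ → Option Γ} {σ : List Γ}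

lemma cut_cells (hσ : σ.length ≤ N) (hx : ∀ r < N, x r = σ[r]?) {r : ℕ} (hr : r ≤ N) :
    Cut (cells N x y r) (cells N x y (r + 1)) ↔ r = σ.length := by
  have h1 : (∀ z, cells N x y r = some z → z.1 ≠ none) ↔ r ≤ σ.length := by
    unfold cells
    split_ifs with h
    · have := hx (r - 1) (by omega)
      simp only [Option.some.injEq, forall_eq', this, ne_eq, List.getElem?_eq_none_iff]
      omega
    · simp only [false_implies, implies_true, true_iff]; omega
  have h2 : (∀ z, cells N x y (r + 1) = some z → z.1 = none) ↔ σ.length ≤ r := by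
    unfold cells
    split_ifs with h
    · have := hx r (by omega)
      simp only [Option.some.injEq, forall_eq', Nat.add_sub_cancel, this,
        List.getElem?_eq_none_iff]
    · simp only [false_implies, implies_true, true_iff]; omega
  rw [Cut, h1, h2]; omega

lemma cells_succ {r : ℕ} (hr : r < N) : cells N x y (r + 1) = some (x r, y r) := by
  simp [cells, hr]

/-- A row satisfying the local conditions performs the action on the stack. -/
lemma rel_of_loc (a : Act Γ) (s : List Γ) (hs : s.length ≤ N)
    (hx : ∀ r < N, x r = s.reverse[r]?)
    (hloc : ∀ r ≤ N, loc a (cells N x y r) (cells N x y (r + 1))) :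
    ∃ s', rel a s s' ∧ s'.length ≤ N ∧ ∀ r < N, y r = s'.reverse[r]? := by
  have hs' : s.reverse.length ≤ N := by simpa using hs
  have hcut : ∀ r ≤ N, Cut (cells N x y r) (cells N x y (r + 1)) ↔ r = s.reverse.length :=
    fun r hr => cut_cells hs' hx hr
  have hsome : ∀ r < N, cells N x y (r + 1) = some (x r, y r) := fun r hr => cells_succ hr
  have keepNext : ∀ r < N, (∀ z, cells N x y (r + 1) = some z → z.2 = z.1) → y r = x r := by
    intro r hr h
    exact h _ (hsome r hr)
  cases a with
  | keep =>
    exact ⟨s, rfl, hs, fun r hr => by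
      rw [keepNext r hr (hloc r hr.le), hx r hr]⟩
  | bot =>
    have h0 : ∀ r < N, x r = none ∧ y r = none := fun r hr => hloc r hr.le _ (hsome r hr)
    have : s = [] := by
      by_contra hne
      have hpos : 0 < s.length := List.length_pos_iff.2 hne
      have h1 := (h0 0 (by omega)).1
      rw [hx 0 (by omega), List.getElem?_eq_none_iff] at h1
      simp at h1; exact hne h1
    subst this
    exact ⟨[], ⟨rfl, rfl⟩, hs, fun r hr => by rw [(h0 r hr).2]; simp⟩
  | push γ =>
    have hl := (hloc _ hs').1 ((hcut _ hs').2 rfl)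
    have hlt : s.reverse.length < N := by
      by_contra hcon
      have : s.reverse.length = N := by omega
      rw [this] at hl
      simp [cells] at hl
    refine ⟨γ :: s, rfl, by simpa using hlt, fun r hr => ?_⟩
    rw [List.reverse_cons]
    by_cases hre : r = s.reverse.length
    · subst hre
      rw [hsome _ hr] at hl
      simp only [Option.some.injEq, Prod.mk.injEq] at hl
      rw [hl.2]; simp
    · have := keepNext r hr ((hloc r hr.le).2 (fun h => hre ((hcut r hr.le).1 h)))
      rw [this, hx r hr]
      rcases lt_or_gt_of_ne hre with h | h
      · rw [List.getElem?_append_left h]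
      · rw [List.getElem?_eq_none_iff.2 (by omega), List.getElem?_eq_none_iff.2 (by simp at *; omega)]
  | pop γ =>
    have hl := (hloc _ hs').1 ((hcut _ hs').2 rfl)
    have hpos : 0 < s.reverse.length ∧ s.reverse.length ≤ N := by
      by_contra hcon
      rw [cells, if_neg hcon] at hl
      simp at hl
    have hidx : s.reverse.length - 1 + 1 = s.reverse.length := by omega
    rw [← hidx, hsome _ (by omega)] at hl
    simp only [Option.some.injEq, Prod.mk.injEq] at hl
    cases s with
    | nil => simp at hpos
    | cons b s =>
      have hxb := hx (s.length) (by simp at hpos; omega)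
      simp only [List.length_reverse, List.length_cons, Nat.add_sub_cancel] at hl
      rw [hl.1] at hxb
      simp at hxb
      subst hxb
      refine ⟨s, rfl, by simp at hs; omega, fun r hr => ?_⟩
      by_cases hre : r = s.length
      · subst hre; rw [hl.2]; simp
      · have := (hloc (r + 1) (by omega)).2
          (fun h => hre (by simpa using (hcut (r + 1) (by omega)).1 h)) _ (hsome r hr)
        rw [show y r = x r from this, hx r hr, List.reverse_cons]
        rcases lt_or_gt_of_ne hre with h | h
        · rw [List.getElem?_append_left (by simpa using h)]
        · rw [List.getElem?_eq_none_iff.2 (by simp; omega),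
            List.getElem?_eq_none_iff.2 (by simp; omega)]
  | top γ =>
    have hl := (hloc _ hs').1 ((hcut _ hs').2 rfl)
    have hpos : 0 < s.reverse.length ∧ s.reverse.length ≤ N := by
      by_contra hcon
      rw [cells, if_neg hcon] at hl
      simp at hl
    have hidx : s.reverse.length - 1 + 1 = s.reverse.length := by omega
    rw [← hidx, hsome _ (by omega)] at hl
    simp only [Option.some.injEq, Prod.mk.injEq] at hl
    refine ⟨s, ⟨rfl, ?_⟩, hs, fun r hr => ?_⟩
    · have hxb := hx (s.reverse.length - 1) (by omega)
      rw [hl.1] at hxb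
      rw [← List.getLast?_reverse, List.getLast?_eq_getElem?]
      exact hxb.symm
    · by_cases hre : r = s.reverse.length - 1
      · subst hre; rw [hl.2, ← hl.1, hx _ hr]
      · have := (hloc (r + 1) (by omega)).2
          (fun h => hre (by have := (hcut (r + 1) (by omega)).1 h; omega)) _ (hsome r hr)
        rw [show y r = x r from this, hx r hr]

/-- The row storing a stack and its successor satisfies the local conditions. -/
lemma loc_of_rel (a : Act Γ) {s s' : List Γ} (h : rel a s s') (hs : s.length ≤ N)
    (hs' : s'.length ≤ N) {r : ℕ} (hr : r ≤ N) :
    loc a (cells N (fun i => s.reverse[i]?) (fun i => s'.reverse[i]?) r)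
      (cells N (fun i => s.reverse[i]?) (fun i => s'.reverse[i]?) (r + 1)) := by
  have hcut := cut_cells (N := N) (y := fun i => s'.reverse[i]?) (σ := s.reverse)
    (x := fun i => s.reverse[i]?) (by simpa using hs) (fun _ _ => rfl) hr
  cases a with
  | keep =>
    rw [rel] at h
    subst h
    intro z hz
    unfold cells at hz; split_ifs at hz; simp at hz; subst hz; rfl
  | bot =>
    obtain ⟨rfl, rfl⟩ := h
    intro z hz
    unfold cells at hz; split_ifs at hz; simp at hz; subst hz; simp
  | push γ =>
    rw [rel] at h
    subst h
    rw [loc, hcut]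
    refine ⟨?_, ?_⟩
    · rintro rfl
      rw [cells_succ (by simpa using hs')]
      simp
    · intro hne z hz
      unfold cells at hz; split_ifs at hz
      simp only [Nat.add_sub_cancel, Option.some.injEq] at hz; subst hz
      simp only [List.reverse_cons]
      rcases lt_or_gt_of_ne hne with h | h
      · rw [List.getElem?_append_left h]
      · rw [List.getElem?_eq_none_iff.2 (by simp at *; omega),
          List.getElem?_eq_none_iff.2 (by simp at *; omega)]
  | pop γ =>
    rw [rel] at h
    subst h
    rw [loc, hcut]
    refine ⟨?_, ?_⟩
    · rintro rfl
      rw [show ((γ :: s').reverse.length) = s'.length + 1 by simp, cells_succ (by simpa using hs)]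
      simp
    · intro hne z hz
      unfold cells at hz; split_ifs at hz
      simp only [Option.some.injEq] at hz; subst hz
      simp only [List.reverse_cons]
      simp at hne
      rcases lt_or_gt_of_ne hne with h | h
      · rw [List.getElem?_append_left (by simp; omega)]
      · rw [List.getElem?_eq_none_iff.2 (by simp at *; omega),
          List.getElem?_eq_none_iff.2 (by simp at *; omega)]
  | top γ =>
    obtain ⟨rfl, h⟩ := h
    rw [loc, hcut]
    refine ⟨?_, ?_⟩
    · rintro rfl
      cases s' with
      | nil => simp at h
      | cons b s =>
        simp at h; subst h
        rw [show ((b :: s).reverse.length) = s.length + 1 by simp, cells_succ (by simpa using hs)]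
        simp
    · intro hne z hz
      unfold cells at hz; split_ifs at hz; simp at hz; subst hz; rfl

end Act

/-! ### Nondeterministic multi-stack machines -/

/-- A nondeterministic machine with stacks indexed by `K`: the elements of `T` are its
transitions. The transitions `start`, `exit` and `fin` are distinguished. -/
structure StackMachine (T K Γ Q : Type) where
  src : T → Q
  tgt : T → Q
  act : T → K → Act Γ
  start : T
  exit : T
  fin : T
  start_ne_fin : start ≠ fin

namespace StackMachine
variable {T K Γ Q : Type}

/-- `M.Reach n k t s`: after `k` transitions with stacks `s`, the machine is about to perform
the transition `t`; the transition `exit` is only allowed after `n` transitions. -/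
inductive Reach (M : StackMachine T K Γ Q) (n : ℕ) : ℕ → T → (K → List Γ) → Prop where
  | start : Reach M n 0 M.start (fun _ => [])
  | step {k t t' s s'} : Reach M n k t s → t ≠ M.fin → M.tgt t = M.src t' →
      (∀ κ, (M.act t κ).rel (s κ) (s' κ)) → (t' = M.exit → k + 1 = n) → Reach M n (k + 1) t' s'

/-- The machine can reach its final transition. -/
def Halts (M : StackMachine T K Γ Q) (n : ℕ) : Prop := ∃ k s, M.Reach n k M.fin s

end StackMachine

end HyTime

namespace HyTime

instance {Γ : Type} [Finite Γ] : Finite (Act Γ) :=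
  Finite.of_surjective (α := Bool ⊕ Γ ⊕ Γ ⊕ Γ)
    (Sum.elim (fun b => cond b Act.keep Act.bot)
      (Sum.elim Act.push (Sum.elim Act.pop Act.top))) (by
    rintro (_ | _ | γ | γ | γ)
    · exact ⟨.inl true, rfl⟩
    · exact ⟨.inl false, rfl⟩
    · exact ⟨.inr (.inl γ), rfl⟩
    · exact ⟨.inr (.inr (.inl γ)), rfl⟩
    · exact ⟨.inr (.inr (.inr γ)), rfl⟩)

namespace Compile
open Turing Turing.PartrecToTM2 StateTransition

instance : Finite K' :=
  Finite.of_surjective (α := Fin 4) ![K'.main, K'.rev, K'.aux, K'.stack] (by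
    rintro (_ | _ | _ | _)
    exacts [⟨0, rfl⟩, ⟨1, rfl⟩, ⟨2, rfl⟩, ⟨3, rfl⟩])

abbrev Stm := TM2.Stmt (fun _ : K' => Γ') Λ' (Option Γ')
abbrev Conf := TM2.Cfg (fun _ : K' => Γ') Λ' (Option Γ')

/-- Control states: a loader for the input, followed by the statements of the
program compiled by Mathlib. -/
inductive Ctl where
  | s | l0 | l1 | l2 | h
  | run (q : Stm) (v : Option Γ')

/-- Act on one stack only. -/
def one (k : K') (a : Act Γ') : K' → Act Γ' := Function.update (fun _ => Act.keep) k a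

def keepAll : K' → Act Γ' := fun _ => Act.keep

lemma rel_one {k : K'} {a : Act Γ'} {s s' : K' → List Γ'} :
    (∀ κ, (one k a κ).rel (s κ) (s' κ)) ↔ ∃ l, a.rel (s k) l ∧ s' = Function.update s k l := by
  constructor
  · intro h
    refine ⟨s' k, by simpa [one] using h k, ?_⟩
    funext κ
    by_cases hκ : κ = k
    · subst hκ; simp
    · have := h κ
      simp only [one, Function.update_of_ne hκ, Act.rel] at this
      simp [Function.update_of_ne hκ, this]
  · rintro ⟨l, hl, rfl⟩ κ
    by_cases hκ : κ = k
    · subst hκ; simpa [one] using hl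
    · simp [one, Function.update_of_ne hκ, Act.rel]

lemma rel_keepAll {s s' : K' → List Γ'} :
    (∀ κ, (keepAll κ).rel (s κ) (s' κ)) ↔ s' = s := by
  simp [keepAll, Act.rel, funext_iff]

variable (c : ToPartrec.Code)

def entry : Λ' := trNormal c Cont'.halt

/-- The admissible transitions between control states. -/
inductive Ok : Ctl → (K' → Act Γ') → Ctl → Prop
  | start : Ok .s (fun _ => .bot) .l0
  | cons : Ok .l0 (one .main (.push .cons)) .l1
  | bit1 : Ok .l1 (one .main (.push .bit1)) .l2
  | bit0 : Ok .l2 (one .main (.push .bit0)) .l2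
  | exit : Ok .l2 keepAll (.run (tr (entry c)) none)
  | push k f q v : Ok (.run (.push k f q) v) (one k (.push (f v))) (.run q v)
  | peek k f q v γ : Ok (.run (.peek k f q) v) (one k (.top γ)) (.run q (f v (some γ)))
  | peekBot k f q v : Ok (.run (.peek k f q) v) (one k .bot) (.run q (f v none))
  | pop k f q v γ : Ok (.run (.pop k f q) v) (one k (.pop γ)) (.run q (f v (some γ)))
  | popBot k f q v : Ok (.run (.pop k f q) v) (one k .bot) (.run q (f v none))
  | load a q v : Ok (.run (.load a q) v) keepAll (.run q (a v))
  | branch f q₁ q₂ v : Ok (.run (.branch f q₁ q₂) v) keepAll (.run (cond (f v) q₁ q₂) v)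
  | goto l v : Ok (.run (.goto l) v) keepAll (.run (tr (l v)) v)
  | halt v : Ok (.run .halt v) keepAll .h
  | fin : Ok .h keepAll .h

abbrev supp : Finset Λ' := codeSupp c Cont'.halt

/-- The finite set of control states that can occur. -/
def Live : Ctl → Prop
  | .run q _ => some q ∈ TM2.stmts tr (supp c)
  | _ => True

lemma finite_live : {q | Live c q}.Finite := by
  refine Set.Finite.subset (((Set.toFinite
    {Ctl.s, Ctl.l0, Ctl.l1, Ctl.l2, Ctl.h}).union
    ((((TM2.stmts tr (supp c)).finite_toSet.prod
      (Set.toFinite (Set.univ : Set (Option Γ'))))).image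
      (fun p => (p.1.elim Ctl.s (fun q => Ctl.run q p.2)))))) ?_
  intro q hq
  cases q with
  | run q v => exact Or.inr ⟨(some q, v), ⟨hq, trivial⟩, rfl⟩
  | _ => left; simp

/-- The transitions of the machine. -/
def Tr : Type :=
  {t : Ctl × (K' → Act Γ') × Ctl // Live c t.1 ∧ Live c t.2.2 ∧ Ok c t.1 t.2.1 t.2.2}

instance : Finite (Tr c) :=
  Set.Finite.to_subtype (Set.Finite.subset
    ((finite_live c).prod (Set.finite_univ.prod (finite_live c)))
    (fun _ ht => ⟨ht.1, trivial, ht.2.1⟩))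

lemma live_tr {l : Λ'} (hl : l ∈ supp c) (v) : Live c (.run (tr l) v) := by
  simp only [Live, TM2.stmts, Finset.mem_insertNone, Finset.mem_biUnion]
  rintro q ⟨⟩
  exact ⟨l, hl, TM2.stmts₁_self⟩

lemma entry_mem : entry c ∈ supp c :=
  (tr_supports c Cont'.halt).1

/-- The stack machine running the code `c`. -/
def machine : StackMachine (Tr c) K' Γ' Ctl where
  src t := t.1.1
  tgt t := t.1.2.2
  act t := t.1.2.1
  start := ⟨(.s, _, .l0), trivial, trivial, .start⟩
  exit := ⟨(.l2, _, _), trivial, live_tr c (entry_mem c) _, .exit⟩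
  fin := ⟨(.h, _, .h), trivial, trivial, .fin⟩
  start_ne_fin h := by
    have := congrArg (fun t : Tr c => t.1.1) h
    cases this

/-- The stacks after loading `n` zeros. -/
def loaded (n : ℕ) : K' → List Γ' :=
  K'.elim (List.replicate n Γ'.bit0 ++ [Γ'.bit1, Γ'.cons]) [] [] []

/-- The configuration has a terminating computation. -/
def Term (C : Conf) : Prop := ∃ b, Reaches (TM2.step tr) C b ∧ TM2.step tr b = none

lemma Term.of_step {l v s} (h : Term (TM2.stepAux (tr l) v s)) : Term ⟨some l, v, s⟩ := by
  obtain ⟨b, hb, h0⟩ := h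
  exact ⟨b, Relation.ReflTransGen.head rfl hb, h0⟩

/-- Invariant along machine computations. -/
def Inv (D : Prop) (k : ℕ) : Ctl → (K' → List Γ') → Prop
  | .s, s => k = 0 ∧ s = fun _ => []
  | .l0, s => k = 1 ∧ s = fun _ => []
  | .l1, s => k = 2 ∧ s = K'.elim [Γ'.cons] [] [] []
  | .l2, s => ∃ m, k = m + 3 ∧ s = loaded m
  | .h, _ => D
  | .run q v, s => Term (TM2.stepAux q v s) → D

lemma elim_nil : (fun _ => [] : K' → List Γ') = K'.elim [] [] [] [] := by
  funext k; cases k <;> rfl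

lemma inv_step {n k : ℕ} {q a q' s s'} (hok : Ok c q a q')
    (hrel : ∀ κ, (a κ).rel (s κ) (s' κ))
    (hexit : q = .l2 → a = keepAll → k = n + 3)
    (h : Inv (Term ⟨some (entry c), none, loaded n⟩) k q s) :
    Inv (Term ⟨some (entry c), none, loaded n⟩) (k + 1) q' s' := by
  cases hok with
  | start =>
    obtain ⟨rfl, rfl⟩ := h
    exact ⟨rfl, funext fun κ => (hrel κ).2⟩
  | cons =>
    obtain ⟨rfl, rfl⟩ := h
    obtain ⟨l, hl, rfl⟩ := rel_one.1 hrel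
    refine ⟨rfl, ?_⟩
    rw [Act.rel] at hl
    rw [hl, elim_nil, K'.elim_update_main]
  | bit1 =>
    obtain ⟨rfl, rfl⟩ := h
    obtain ⟨l, hl, rfl⟩ := rel_one.1 hrel
    refine ⟨0, rfl, ?_⟩
    rw [Act.rel] at hl
    rw [hl, K'.elim_update_main]; rfl
  | bit0 =>
    obtain ⟨m, rfl, rfl⟩ := h
    obtain ⟨l, hl, rfl⟩ := rel_one.1 hrel
    refine ⟨m + 1, rfl, ?_⟩
    rw [Act.rel] at hl
    rw [hl, loaded, K'.elim_update_main]; rfl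
  | exit =>
    obtain ⟨m, hm, rfl⟩ := h
    have := hexit rfl rfl
    obtain rfl : m = n := by omega
    rw [rel_keepAll] at hrel
    subst hrel
    exact fun ht => ht.of_step
  | push k f q v =>
    obtain ⟨l, hl, rfl⟩ := rel_one.1 hrel
    rw [Act.rel] at hl; subst hl
    exact h
  | peek k f q v γ =>
    obtain ⟨l, ⟨rfl, hl⟩, rfl⟩ := rel_one.1 hrel
    intro ht
    apply h
    rw [Function.update_eq_self] at ht
    simpa only [TM2.stepAux, hl] using ht
  | peekBot k f q v =>
    obtain ⟨l, ⟨hl, rfl⟩, rfl⟩ := rel_one.1 hrel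
    intro ht
    apply h
    rw [← hl, Function.update_eq_self] at ht
    simpa only [TM2.stepAux, hl, List.head?_nil, List.head?_cons, List.tail_cons, List.tail_nil] using ht
  | pop k f q v γ =>
    obtain ⟨l, hl, rfl⟩ := rel_one.1 hrel
    rw [Act.rel] at hl
    intro ht
    apply h
    simpa only [TM2.stepAux, hl, List.head?_nil, List.head?_cons, List.tail_cons, List.tail_nil] using ht
  | popBot k f q v =>
    obtain ⟨l, ⟨hl, rfl⟩, rfl⟩ := rel_one.1 hrel
    intro ht
    apply h
    simpa only [TM2.stepAux, hl, List.head?_nil, List.head?_cons, List.tail_cons, List.tail_nil] using ht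
  | load a q v => rw [rel_keepAll] at hrel; subst hrel; exact h
  | branch f q₁ q₂ v =>
    rw [rel_keepAll] at hrel; subst hrel
    intro ht
    apply h
    simp only [TM2.stepAux]
    cases hf : f v <;> simpa [hf] using ht
  | goto l v => rw [rel_keepAll] at hrel; subst hrel; exact fun ht => h ht.of_step
  | halt v => exact h ⟨_, Relation.ReflTransGen.refl, rfl⟩
  | fin => exact h

lemma exit_index {n k t s} (h : (machine c).Reach n k t s) (ht : t = (machine c).exit) :
    k = n := by
  cases h with
  | start =>
    have := congrArg (fun t : Tr c => t.1.1) ht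
    cases this
  | step _ _ _ _ h5 => exact h5 ht

lemma term_of_halts {n : ℕ} (h : (machine c).Halts (n + 3)) :
    Term ⟨some (entry c), none, loaded n⟩ := by
  obtain ⟨k, s, h⟩ := h
  suffices ∀ t, (machine c).Reach (n + 3) k t s →
      Inv (Term ⟨some (entry c), none, loaded n⟩) k ((machine c).src t) s from this _ h
  clear h
  intro t h
  induction h with
  | start => exact ⟨rfl, rfl⟩
  | @step k t t' s s' h1 h2 h3 h4 h5 ih =>
    rw [← h3]
    refine inv_step c t.2.2.2 h4 (fun hq ha => exit_index c h1 ?_) ih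
    obtain ⟨⟨q, a, q'⟩, hl, hl', hok⟩ := t
    change q = _ at hq
    change a = _ at ha
    subst hq
    cases hok with
    | bit0 =>
      have := congrFun ha K'.main
      simp [keepAll] at this
    | exit => rfl

/-- The machine can be about to leave the control state `q` at step `k` with stacks `s`. -/
def At (n k : ℕ) (q : Ctl) (s : K' → List Γ') : Prop :=
  ∀ t : Tr c, (machine c).src t = q → (t = (machine c).exit → k = n) → (machine c).Reach n k t s

variable {c} in
lemma At.step {n k : ℕ} {q a q' s s'} (h : At c n k q s) (hok : Ok c q a q') (hq : q ≠ .h)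
    (hl : Live c q) (hl' : Live c q') (hrel : ∀ κ, (a κ).rel (s κ) (s' κ))
    (hexit : q = .l2 → a = keepAll → k = n) : At c n (k + 1) q' s' := by
  intro t' ht' hexit'
  have h0 := h ⟨(q, a, q'), hl, hl', hok⟩ rfl (fun he => by
    have h1 : q = .l2 := congrArg (fun t : Tr c => t.1.1) he
    have h2 : a = keepAll := congrArg (fun t : Tr c => t.1.2.1) he
    exact hexit h1 h2)
  refine .step h0 (fun he => hq (congrArg (fun t : Tr c => t.1.1) he)) ht'.symm hrel hexit'

/-- The machine has simulated the configuration `C`. -/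
def AtConf (n k : ℕ) : Conf → Prop
  | ⟨none, _, s⟩ => At c n k .h s
  | ⟨some l, v, s⟩ => l ∈ supp c ∧ At c n k (.run (tr l) v) s

lemma atConf_stepAux {n : ℕ} (q : Stm) : ∀ {k v s}, Live c (.run q v) →
    At c n k (.run q v) s → ∃ k', AtConf c n k' (TM2.stepAux q v s) := by
  have sub : ∀ {q q' : Stm} {v v'}, Live c (.run q v) → q' ∈ TM2.stmts₁ q →
      Live c (.run q' v') := fun hl hq => TM2.stmts_trans hq hl
  induction q with
  | push k f q ih =>
    intro k v s hl h
    have hl' : ∀ v', Live c (.run q v') := fun v' =>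
      sub hl (by simp [TM2.stmts₁, TM2.stmts₁_self])
    exact ih (hl' _) (h.step (.push _ f q v) (by simp) hl (hl' _)
      (rel_one.2 ⟨_, rfl, rfl⟩) (by simp))
  | peek k f q ih =>
    intro _ v s hl h
    have hl' : ∀ v', Live c (.run q v') := fun v' =>
      sub hl (by simp [TM2.stmts₁, TM2.stmts₁_self])
    cases hs : s k with
    | nil =>
      simp only [TM2.stepAux, hs]
      exact ih (hl' _) (h.step (.peekBot _ f q v) (by simp) hl (hl' _)
        (rel_one.2 ⟨[], ⟨hs, rfl⟩, by rw [← hs, Function.update_eq_self]⟩) (by simp))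
    | cons γ l =>
      simp only [TM2.stepAux, hs]
      exact ih (hl' _) (h.step (.peek _ f q v γ) (by simp) hl (hl' _)
        (rel_one.2 ⟨s k, ⟨rfl, by rw [hs]; rfl⟩, by rw [Function.update_eq_self]⟩)
        (by simp))
  | pop k f q ih =>
    intro _ v s hl h
    have hl' : ∀ v', Live c (.run q v') := fun v' =>
      sub hl (by simp [TM2.stmts₁, TM2.stmts₁_self])
    cases hs : s k with
    | nil =>
      simp only [TM2.stepAux, hs]
      exact ih (hl' _) (h.step (.popBot _ f q v) (by simp) hl (hl' _)
        (rel_one.2 ⟨[], ⟨hs, rfl⟩, rfl⟩) (by simp))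
    | cons γ l =>
      simp only [TM2.stepAux, hs]
      exact ih (hl' _) (h.step (.pop _ f q v γ) (by simp) hl (hl' _)
        (rel_one.2 ⟨l, hs, rfl⟩) (by simp))
  | load a q ih =>
    intro _ v s hl h
    have hl' : ∀ v', Live c (.run q v') := fun v' =>
      sub hl (by simp [TM2.stmts₁, TM2.stmts₁_self])
    exact ih (hl' _) (h.step (.load a q v) (by simp) hl (hl' _) (rel_keepAll.2 rfl)
      (by simp))
  | branch f q₁ q₂ ih₁ ih₂ =>
    intro _ v s hl h
    have h1 : ∀ v', Live c (.run q₁ v') := fun v' =>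
      sub hl (by simp [TM2.stmts₁, TM2.stmts₁_self])
    have h2 : ∀ v', Live c (.run q₂ v') := fun v' =>
      sub hl (by simp [TM2.stmts₁, TM2.stmts₁_self])
    have := h.step (.branch f q₁ q₂ v) (by simp) hl (by cases f v <;> simp [h1, h2])
      (rel_keepAll.2 rfl) (by simp)
    simp only [TM2.stepAux]
    cases hf : f v
    · rw [hf] at this; exact ih₂ (h2 _) this
    · rw [hf] at this; exact ih₁ (h1 _) this
  | goto l =>
    intro k v s hl h
    have hmem : l v ∈ supp c :=
      by
        let : Inhabited Λ' := ⟨trNormal c Cont'.halt⟩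
        exact TM2.stmts_supportsStmt (tr_supports c _) hl v
    exact ⟨k + 1, hmem, h.step (.goto l v) (by simp) hl (live_tr c hmem _) (rel_keepAll.2 rfl)
      (by simp)⟩
  | halt =>
    intro k v s hl h
    exact ⟨k + 1, h.step (.halt v) (by simp) hl trivial (rel_keepAll.2 rfl) (by simp)⟩

lemma halts_of_atConf {n : ℕ} {C b : Conf} (hb : Reaches (TM2.step tr) C b)
    (h0 : TM2.step tr b = none) : ∀ k, AtConf c n k C → (machine c).Halts n := by
  induction hb using Relation.ReflTransGen.head_induction_on with
  | refl =>
    intro k h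
    obtain ⟨_ | l, v, s⟩ := b
    · refine ⟨k, s, h _ rfl (fun he => ?_)⟩
      have := congrArg (fun t : Tr c => t.1.1) he
      cases this
    · simp [TM2.step] at h0
  | @head a b' hab _ ih =>
    intro k h
    obtain ⟨_ | l, v, s⟩ := a
    · simp [TM2.step] at hab
    · simp only [TM2.step, Option.mem_def, Option.some.injEq] at hab
      obtain ⟨k', hk'⟩ := atConf_stepAux c _ (live_tr c h.1 v) h.2
      rw [hab] at hk'
      exact ih k' hk'

lemma at_loaded {n : ℕ} : ∀ m ≤ n, At c (n + 3) (m + 3) .l2 (loaded m) := by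
  intro m hm
  induction m with
  | zero =>
    have h0 : At c (n + 3) 0 .s (fun _ => []) := by
      intro t ht _
      obtain ⟨⟨q, a, q'⟩, hl, hl', hok⟩ := t
      change q = _ at ht
      subst ht
      cases hok
      exact .start
    have h1 : At c (n + 3) 1 .l0 (fun _ => []) :=
      h0.step .start (by simp) trivial trivial (fun _ => ⟨rfl, rfl⟩) (by simp)
    have h2 : At c (n + 3) 2 .l1 (K'.elim [Γ'.cons] [] [] []) :=
      h1.step .cons (by simp) trivial trivial
        (rel_one.2 ⟨_, rfl, by rw [elim_nil, K'.elim_update_main]⟩) (by simp)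
    exact h2.step .bit1 (by simp) trivial trivial
        (rel_one.2 ⟨_, rfl, by rw [K'.elim_update_main]; rfl⟩) (by simp)
  | succ m ih =>
    refine (ih (by omega)).step .bit0 (by simp) trivial trivial
      (rel_one.2 ⟨_, rfl, by rw [loaded, loaded, K'.elim_update_main]; rfl⟩) (fun _ h => ?_)
    have := congrFun h K'.main
    simp [one, keepAll] at this

lemma halts_iff_term {n : ℕ} :
    (machine c).Halts (n + 3) ↔ Term ⟨some (entry c), none, loaded n⟩ := by
  refine ⟨term_of_halts c, ?_⟩
  rintro ⟨b, hb, h0⟩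
  refine halts_of_atConf c hb h0 (n + 3 + 1) ⟨entry_mem c, ?_⟩
  exact (at_loaded c n le_rfl).step .exit (by simp) trivial (live_tr c (entry_mem c) _)
    (rel_keepAll.2 rfl) (by simp)

lemma trNat_two_pow (n : ℕ) : trNat (2 ^ n) = List.replicate n Γ'.bit0 ++ [Γ'.bit1] := by
  have key : ∀ n : ℕ, ∃ p : PosNum, ((2 ^ n : ℕ) : Num) = Num.pos p ∧
      trPosNum p = List.replicate n Γ'.bit0 ++ [Γ'.bit1] := by
    intro n
    induction n with
    | zero => exact ⟨PosNum.one, by simp; rfl, rfl⟩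
    | succ n ih =>
      obtain ⟨p, h1, h2⟩ := ih
      refine ⟨p.bit0, ?_, by simp [trPosNum, h2, List.replicate_succ]⟩
      rw [pow_succ, mul_two, Nat.cast_add, h1]
      exact Num.bit0_of_bit0 (Num.pos p)
  obtain ⟨p, h1, h2⟩ := key n
  rw [trNat, h1]
  exact h2

lemma halts_iff_dom {n : ℕ} : (machine c).Halts (n + 3) ↔ (c.eval [2 ^ n]).Dom := by
  have h : (eval (TM2.step tr) (PartrecToTM2.init c [2 ^ n])).Dom ↔
      (c.eval [2 ^ n]).Dom := by
    rw [PartrecToTM2.tr_eval]; rfl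
  rw [halts_iff_term, ← h, Part.dom_iff_mem]
  have hi : PartrecToTM2.init c [2 ^ n] = ⟨some (entry c), none, loaded n⟩ := by
    simp [PartrecToTM2.init, trList, trNat_two_pow, loaded, entry]
    rfl
  rw [hi]
  exact exists_congr fun b => mem_eval.symm

/-- Every partial recursive function has its domain described by a stack machine. -/
lemma exists_machine {f : ℕ →. ℕ} (hf : Partrec f) :
    ∃ c : ToPartrec.Code, ∀ n, (machine c).Halts (n + 3) ↔ (f n).Dom := by
  let F : ℕ → ℕ →. Bool := fun x k => Part.some (decide (2 ^ k = x))
  let g : ℕ →. ℕ := fun x => (Nat.rfind (F x)).bind f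
  have hF : Partrec₂ F := by
    have h1 : Primrec₂ ((· ^ ·) : ℕ → ℕ → ℕ) := Primrec₂.unpaired'.1 Nat.Primrec.pow
    have h2 : Primrec fun p : ℕ × ℕ => decide (2 ^ p.2 = p.1) :=
      Primrec.eq.decide.comp (h1.comp (Primrec.const 2) Primrec.snd) Primrec.fst
    exact h2.to_comp.partrec
  have hg : Partrec g :=
    Partrec.bind (Partrec.rfind hF)
      (hf.comp (Computable.snd : Computable (Prod.snd : ℕ × ℕ → ℕ))).to₂
  obtain ⟨c, hc⟩ := ToPartrec.Code.exists_code (Nat.Partrec'.part_iff₁.2 hg)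
  refine ⟨c, fun n => ?_⟩
  rw [halts_iff_dom]
  have h1 := hc ⟨[2 ^ n], rfl⟩
  change c.eval [2 ^ n] = pure <$> g (2 ^ n) at h1
  have h2 : Nat.rfind (F (2 ^ n)) = Part.some n := by
    refine Part.eq_some_iff.2 (Nat.mem_rfind.2 ⟨by simp [F], fun {m} hm => ?_⟩)
    have : m ≠ n := hm.ne
    simp [F, this]
  have h3 : g (2 ^ n) = f n := by
    change (Nat.rfind (F (2 ^ n))).bind f = f n
    rw [h2]
    exact Part.bind_some n f
  rw [h1, h3]
  rfl

end Compile

end HyTime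

namespace HyTime

/-! ### Timed tilings -/

/-- A tiling system with horizontal and vertical constraints, whose letters marked `ctl`
begin the rows, and with a first letter, a last letter and a distinguished letter. -/
structure Tiling (Λ : Type) where
  H : Λ → Λ → Prop
  V : Λ → Λ → Prop
  ctl : Λ → Prop
  first : Λ
  last : Λ
  mark : Λ
  ctl_first : ctl first
  not_H_last : ∀ a, ¬ H last a

/-- Control states of the automaton associated with a tiling system: `pt a` is visited at the
time when the letter `a` occurs and `gap a` afterwards, until the next letter. The states
`m1`, `gm`, `m2` compare two instants at distance one, and `idle` is initial. -/
inductive St (Λ : Type) where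
  | idle | m1 | gm | m2
  | pt (a : Λ) | gap (a : Λ)

section TimedWord
variable {Λ : Type}

open Classical in
/-- The time elapsed when reaching position `j`, since the last row began. -/
noncomputable def rowClock (X : Tiling Λ) (w : ℕ → Λ) (τ : ℕ → ℝ) : ℕ → ℝ
  | 0 => τ 0
  | j + 1 => (if X.ctl (w j) then 0 else rowClock X w τ j) + (τ (j + 1) - τ j)

/-- A timed word `(w 0, τ 0), …, (w L, τ L)` whose rows have duration one. -/
structure TimedWord (X : Tiling Λ) (m L : ℕ) (w : ℕ → Λ) (τ : ℕ → ℝ) : Prop where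
  first : w 0 = X.first
  last : w L = X.last
  horiz : ∀ j < L, X.H (w j) (w (j + 1))
  pos : 0 < τ 0
  lt_succ : ∀ j < L, τ j < τ (j + 1)
  row : ∀ j ≤ L, X.ctl (w j) → rowClock X w τ j = 1
  mark : ∀ j ≤ L, w j = X.mark → τ j = m + 1

/-- The state `s` is observed at time `t` along a timed word. -/
def WordObs (L : ℕ) (w : ℕ → Λ) (τ : ℕ → ℝ) (t : ℝ) : St Λ → Prop
  | .idle => 0 ≤ t ∧ t < τ 0
  | .pt a => ∃ j ≤ L, w j = a ∧ t = τ j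
  | .gap a => ∃ j < L, w j = a ∧ τ j < t ∧ t < τ (j + 1)
  | _ => False

/-- Observations allowed at two instants at distance one. -/
def Tiling.Match (X : Tiling Λ) : St Λ → St Λ → Prop
  | .pt a, .pt b => X.V a b
  | .gap _, .gap _ => True
  | _, _ => False

/-- The observations at distance one match from time one on. -/
def Matching (X : Tiling Λ) (L : ℕ) (w : ℕ → Λ) (τ : ℕ → ℝ) : Prop :=
  ∀ t, 1 ≤ t → t + 1 ≤ τ L →
    ∃ s s', X.Match s s' ∧ WordObs L w τ t s ∧ WordObs L w τ (t + 1) s'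

namespace TimedWord
variable {X : Tiling Λ} {m L : ℕ} {w : ℕ → Λ} {τ : ℕ → ℝ}

lemma lt (h : TimedWord X m L w τ) {i j : ℕ} (hij : i < j) (hj : j ≤ L) : τ i < τ j := by
  induction j, hij using Nat.le_induction with
  | base => exact h.lt_succ _ hj
  | succ j _ ih => exact (ih (by omega)).trans (h.lt_succ _ hj)

lemma le (h : TimedWord X m L w τ) {i j : ℕ} (hij : i ≤ j) (hj : j ≤ L) : τ i ≤ τ j := by
  rcases hij.eq_or_lt with rfl | hij
  · exact le_rfl
  · exact (h.lt hij hj).le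

lemma lt_iff (h : TimedWord X m L w τ) {i j : ℕ} (hi : i ≤ L) (hj : j ≤ L) :
    τ i < τ j ↔ i < j :=
  ⟨fun hlt => by by_contra hc; exact absurd (h.le (not_lt.1 hc) hi) (not_le.2 hlt),
    fun hlt => h.lt hlt hj⟩

lemma inj (h : TimedWord X m L w τ) {i j : ℕ} (hi : i ≤ L) (hj : j ≤ L) (he : τ i = τ j) :
    i = j := by
  have h1 := h.lt_iff hi hj
  have h2 := h.lt_iff hj hi
  rw [he] at h1 h2
  simp only [lt_irrefl, false_iff] at h1 h2
  omega

lemma zero (h : TimedWord X m L w τ) : τ 0 = 1 :=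
  h.row 0 (Nat.zero_le _) (h.first ▸ X.ctl_first)

lemma obs_pt (h : TimedWord X m L w τ) {j : ℕ} (hj : j ≤ L) {s} (hs : WordObs L w τ (τ j) s) :
    s = .pt (w j) := by
  cases s with
  | idle => exact absurd (h.le (Nat.zero_le j) hj) (not_le.2 hs.2)
  | pt a =>
    obtain ⟨i, hi, rfl, he⟩ := hs
    rw [h.inj hj hi he]
  | gap a =>
    obtain ⟨i, hi, rfl, h1, h2⟩ := hs
    have h1 := (h.lt_iff (by omega) hj).1 h1
    have h2 := (h.lt_iff hj (by omega)).1 h2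
    omega
  | _ => exact hs.elim

lemma obs_gap (h : TimedWord X m L w τ) {j : ℕ} (hj : j < L) {t} (h1 : τ j < t)
    (h2 : t < τ (j + 1)) {s} (hs : WordObs L w τ t s) : ∃ a, s = .gap a := by
  cases s with
  | idle => exact absurd ((h.le (Nat.zero_le j) hj.le).trans h1.le) (not_le.2 hs.2)
  | pt a =>
    obtain ⟨i, hi, rfl, rfl⟩ := hs
    have h1 := (h.lt_iff (by omega) hi).1 h1
    have h2 := (h.lt_iff hi (by omega)).1 h2
    omega
  | gap a => exact ⟨a, rfl⟩
  | _ => exact hs.elim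

lemma rowClock_eq {i : ℕ} (hi : X.ctl (w i)) {j : ℕ} (hij : i < j)
    (hn : ∀ k, i < k → k < j → ¬ X.ctl (w k)) : rowClock X w τ j = τ j - τ i := by
  induction j, hij using Nat.le_induction with
  | base => simp [rowClock, hi]
  | succ j hij ih =>
    rw [rowClock, if_neg (hn j hij (by omega)), ih (fun k h1 h2 => hn k h1 (by omega))]
    ring

/-- The length of the first row. -/
lemma exists_width (h : TimedWord X m L w τ) (hlast : X.ctl X.last) (hne : X.first ≠ X.last) :
    ∃ N, 0 < N ∧ N ≤ L ∧ X.ctl (w N) ∧ (∀ k, 0 < k → k < N → ¬ X.ctl (w k)) ∧ τ N = 2 := by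
  classical
  have hL : 0 < L := by
    rcases Nat.eq_zero_or_pos L with h0 | h0
    · exact absurd (h.first.symm.trans (h0 ▸ h.last)) hne
    · exact h0
  have hex : ∃ N, 0 < N ∧ X.ctl (w N) := ⟨L, hL, h.last ▸ hlast⟩
  obtain ⟨hN, hc⟩ := Nat.find_spec hex
  have hle : Nat.find hex ≤ L := Nat.find_min' hex ⟨hL, h.last ▸ hlast⟩
  have hmin : ∀ k, 0 < k → k < Nat.find hex → ¬ X.ctl (w k) := fun k h1 h2 h3 =>
    Nat.find_min hex h2 ⟨h1, h3⟩
  refine ⟨Nat.find hex, hN, hle, hc, hmin, ?_⟩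
  have h1 := h.row _ hle hc
  rw [rowClock_eq (h.first ▸ X.ctl_first) hN hmin, h.zero] at h1
  linarith

/-- Matching forces the rows to repeat the timing of the first one. -/
lemma period (h : TimedWord X m L w τ) (hm : Matching X L w τ) {N : ℕ}
    (hN0 : 0 < N) (hτ : τ N = 2) :
    ∀ j, N + j ≤ L → τ (N + j) = τ j + 1 ∧ X.V (w j) (w (N + j)) := by
  have hone : ∀ j ≤ L, 1 ≤ τ j := fun j hj => h.zero ▸ h.le (Nat.zero_le j) hj
  have hV : ∀ j, N + j ≤ L → τ (N + j) = τ j + 1 → X.V (w j) (w (N + j)) := by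
    intro j hj he
    obtain ⟨s, s', hs, h1, h2⟩ := hm (τ j) (hone j (by omega)) (he ▸ h.le hj le_rfl)
    rw [← he] at h2
    rw [h.obs_pt (by omega) h1, h.obs_pt hj h2] at hs
    exact hs
  intro j hj
  refine ⟨?_, hV j hj ?_⟩ <;> clear hV <;> {
    induction j with
    | zero => rw [h.zero, Nat.add_zero, hτ]; norm_num
    | succ j ih =>
      have ih := ih (by omega)
      have hle : τ (j + 1) + 1 ≤ τ (N + (j + 1)) := by
        by_contra hc
        have h3 := h.lt (i := N + j) (j := N + (j + 1)) (by omega) hj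
        have h4 := hone j (by omega)
        obtain ⟨s, s', hs, h1, h2⟩ := hm (τ (N + (j + 1)) - 1) (by linarith)
          (by linarith [h.le hj le_rfl])
        obtain ⟨a, rfl⟩ := h.obs_gap (j := j) (by omega) (by linarith) (by linarith) h1
        rw [sub_add_cancel] at h2
        rw [h.obs_pt hj h2] at hs
        exact hs
      obtain ⟨s, s', hs, h1, h2⟩ := hm (τ (j + 1)) (hone _ (by omega))
        (hle.trans (h.le hj le_rfl))
      rw [h.obs_pt (by omega) h1] at hs
      cases s' with
      | pt b =>
        obtain ⟨i, hi, rfl, he⟩ := h2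
        have h5 := h.lt_succ j (by omega)
        have h6 : N + j < i := (h.lt_iff (by omega) hi).1 (by linarith)
        have h7 := h.le (i := N + (j + 1)) (j := i) (by omega) hi
        linarith
      | _ => exact hs.elim }

end TimedWord

end TimedWord

/-! ### The tiling system of a stack machine -/

namespace StackMachine
variable {T K Γ Q : Type} (M : StackMachine T K Γ Q)

/-- A transition together with the content of a cell, or no cell at the beginning of a row. -/
abbrev Letter (T K Γ : Type) : Type := T × Option (K → Option Γ × Option Γ)

/-- Rows describe successive transitions: the cells hold the stacks before and after. -/
def tiling : Tiling (Letter T K Γ) where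
  H a b := ¬ (a.2 = none ∧ b.2 = none) ∧ a ≠ (M.fin, none) ∧
    (b.2 = none → M.tgt a.1 = M.src b.1) ∧ (b.2 ≠ none → a.1 = b.1) ∧
    ∀ κ, (M.act a.1 κ).loc (a.2.map (· κ)) (b.2.map (· κ))
  V a b := (a.2 = none ↔ b.2 = none) ∧
    ∀ f g, a.2 = some f → b.2 = some g → ∀ κ, (f κ).2 = (g κ).1
  ctl a := a.2 = none
  first := (M.start, none)
  last := (M.fin, none)
  mark := (M.exit, none)
  ctl_first := rfl
  not_H_last _ h := h.2.1 rfl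

variable {M}

section Sound
variable {m L : ℕ} {w : ℕ → Letter T K Γ} {τ : ℕ → ℝ}

lemma halts_of_timedWord (hbot : ∀ κ, M.act M.start κ = Act.bot)
    (h : TimedWord M.tiling m L w τ) (hm : Matching M.tiling L w τ) : M.Halts m := by
  obtain ⟨N, hN0, hNL, hNc, hNmin, hτN⟩ := h.exists_width rfl
    (fun he => M.start_ne_fin (congrArg Prod.fst he))
  have hper := h.period hm hN0 hτN
  have hctl : ∀ j ≤ L, ((w j).2 = none ↔ N ∣ j) := by
    intro j
    induction j using Nat.strong_induction_on with
    | _ j ih =>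
      intro hj
      by_cases hjN : j < N
      · rcases Nat.eq_zero_or_pos j with rfl | hj0
        · simp [h.first, tiling]
        · exact ⟨fun hc => absurd hc (hNmin j hj0 hjN),
            fun hd => absurd (Nat.le_of_dvd hj0 hd) (by omega)⟩
      · obtain ⟨i, rfl⟩ := Nat.exists_eq_add_of_le (not_lt.1 hjN)
        have h1 : (w i).2 = none ↔ (w (N + i)).2 = none := (hper i hj).2.1
        rw [← h1, ih i (by omega) (by omega)]
        simp
  obtain ⟨k, hk⟩ : N ∣ L := (hctl L le_rfl).1 (by rw [h.last]; rfl)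
  rw [mul_comm] at hk
  have hrow : ∀ {i}, i < k → i * N + N ≤ L := by
    intro i hi
    rw [hk, ← Nat.succ_mul]
    exact Nat.mul_le_mul_right N hi
  have hcell : ∀ {i r}, i < k → 0 < r → r < N → (w (i * N + r)).2 ≠ none := by
    intro i r hi h0 hr hc
    rw [hctl _ (by have := hrow hi; omega), Nat.dvd_add_right (Dvd.intro_left i rfl)] at hc
    exact absurd (Nat.le_of_dvd h0 hc) (by omega)
  have hstart : ∀ {i}, i ≤ k → (w (i * N)).2 = none := fun {i} hi =>
    (hctl _ (hk ▸ Nat.mul_le_mul_right N hi)).2 (Dvd.intro_left i rfl)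
  have hT : ∀ {i r}, i < k → r < N → (w (i * N + r)).1 = (w (i * N)).1 := by
    intro i r hi
    induction r with
    | zero => intro _; rfl
    | succ r ih =>
      intro hr
      rw [← ih (by omega)]
      exact ((h.horiz (i * N + r) (by have := hrow hi; omega)).2.2.2.1
        (hcell hi (Nat.succ_pos r) hr)).symm
  let x : ℕ → K → ℕ → Option Γ := fun i κ r => ((w (i * N + (r + 1))).2.map (· κ)).bind Prod.fst
  let y : ℕ → K → ℕ → Option Γ := fun i κ r => ((w (i * N + (r + 1))).2.map (· κ)).bind Prod.snd
  have hcells : ∀ {i r} κ, i < k → r ≤ N →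
      Act.cells (N - 1) (x i κ) (y i κ) r = (w (i * N + r)).2.map (· κ) := by
    intro i r κ hi hr
    unfold Act.cells
    split_ifs with hc
    · have hne := hcell hi hc.1 (by omega : r < N)
      have he : r - 1 + 1 = r := by omega
      simp only [x, y, he]
      cases hw : (w (i * N + r)).2 with
      | none => exact absurd hw hne
      | some f => rfl
    · have : (w (i * N + r)).2 = none := by
        rw [hctl _ (by have := hrow hi; omega)]
        rcases Nat.eq_zero_or_pos r with rfl | h0
        · exact Dvd.intro_left i rfl
        · obtain rfl : r = N := by omega
          rw [← Nat.succ_mul]; exact Dvd.intro_left _ rfl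
      rw [this]; rfl
  have hloc : ∀ {i r} κ, i < k → r < N → (M.act (w (i * N)).1 κ).loc
      (Act.cells (N - 1) (x i κ) (y i κ) r) (Act.cells (N - 1) (x i κ) (y i κ) (r + 1)) := by
    intro i r κ hi hr
    rw [hcells κ hi hr.le, hcells κ hi hr, ← hT hi hr]
    exact (h.horiz (i * N + r) (by have := hrow hi; omega)).2.2.2.2 κ
  have htime : ∀ i ≤ k, τ (i * N) = 1 + i := by
    intro i
    induction i with
    | zero => intro _; simp [h.zero]
    | succ i ih =>
      intro hi
      have h1 := (hper (i * N) (by have := hrow hi; omega)).1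
      rw [show N + i * N = (i + 1) * N by ring, ih (by omega)] at h1
      rw [h1]; push_cast; ring
  have main : ∀ i ≤ k, ∃ s, M.Reach m i (w (i * N)).1 s ∧ ∀ κ, (s κ).length ≤ N - 1 ∧
      (i < k → ∀ r < N - 1, x i κ r = (s κ).reverse[r]?) := by
    intro i
    induction i with
    | zero =>
      intro _
      refine ⟨fun _ => [], ?_, fun κ => ⟨by simp, fun hi r hr => ?_⟩⟩
      · rw [Nat.zero_mul, h.first]; exact .start
      · have h1 := hloc (r := r) κ hi (by omega)
        rw [Nat.zero_mul, h.first] at h1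
        change (M.act M.start κ).loc _ _ at h1
        rw [hbot, Act.cells_succ hr] at h1
        simpa using (h1 _ rfl).1
    | succ i ih =>
      intro hi
      obtain ⟨s, hs, hx⟩ := ih (by omega)
      choose s' h1 h2 h3 using fun κ => Act.rel_of_loc (M.act (w (i * N)).1 κ) (s κ) (hx κ).1
        ((hx κ).2 hi) (y := y i κ) (fun r hr => hloc κ hi (by omega))
      have hnext : i * N + (N - 1) + 1 = (i + 1) * N := by
        rw [Nat.succ_mul]; omega
      refine ⟨s', .step hs ?_ ?_ h1 ?_, fun κ => ⟨h2 κ, fun hi' r hr => ?_⟩⟩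
      · intro he
        refine M.tiling.not_H_last (w (i * N + 1)) ?_
        have := h.horiz (i * N) (by have := hrow hi; omega)
        rwa [show w (i * N) = M.tiling.last from Prod.ext he (hstart (by omega))] at this
      · have h4 := h.horiz (i * N + (N - 1)) (by have := hrow hi; omega)
        rw [hnext] at h4
        rw [← hT (r := N - 1) hi (by omega)]
        exact h4.2.2.1 (hstart hi)
      · intro he
        have h4 := h.mark ((i + 1) * N) (hk ▸ Nat.mul_le_mul_right N hi)
          (Prod.ext he (hstart hi))
        rw [htime _ hi] at h4
        have : ((i + 1 : ℕ) : ℝ) = m := by linarith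
        exact_mod_cast this
      · rw [← h3 κ r hr]
        have h4 := (hper (i * N + (r + 1)) (by have := hrow hi'; rw [Nat.succ_mul] at this; omega)).2.2
        rw [show N + (i * N + (r + 1)) = (i + 1) * N + (r + 1) by ring] at h4
        simp only [x, y]
        cases hf : (w (i * N + (r + 1))).2 with
        | none => exact absurd hf (hcell (by omega) (Nat.succ_pos r) (by omega))
        | some f =>
          cases hg : (w ((i + 1) * N + (r + 1))).2 with
          | none => exact absurd hg (hcell hi' (Nat.succ_pos r) (by omega))
          | some g => exact (h4 f g hf hg κ).symm
  obtain ⟨s, hs, -⟩ := main k le_rfl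
  rw [← hk, h.last] at hs
  exact ⟨k, s, hs⟩

end Sound

/-- Reachable situations are the ends of computations. -/
lemma Reach.exists_run {m k t s} (h : M.Reach m k t s) :
    ∃ (t' : ℕ → T) (s' : ℕ → K → List Γ), t' 0 = M.start ∧ (s' 0 = fun _ => []) ∧ t' k = t ∧
      s' k = s ∧ ∀ i < k, t' i ≠ M.fin ∧ M.tgt (t' i) = M.src (t' (i + 1)) ∧
        (∀ κ, (M.act (t' i) κ).rel (s' i κ) (s' (i + 1) κ)) ∧
        (t' (i + 1) = M.exit → i + 1 = m) := by
  induction h with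
  | start => exact ⟨fun _ => M.start, fun _ _ => [], rfl, rfl, rfl, rfl, by simp⟩
  | @step k t u s v _ h2 h3 h4 h5 ih =>
    obtain ⟨t', s', ht0, hs0, rfl, rfl, hi⟩ := ih
    refine ⟨fun i => if i ≤ k then t' i else u, fun i => if i ≤ k then s' i else v,
      by simpa using ht0, by simpa using hs0, by simp, by simp, fun i hik => ?_⟩
    rcases Nat.lt_succ_iff_lt_or_eq.1 hik with hlt | rfl
    · simp only [if_pos hlt.le, if_pos (Nat.succ_le_of_lt hlt)]
      exact hi i hlt
    · simp only [le_refl, if_true, Nat.not_succ_le_self, if_false]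
      exact ⟨h2, h3, h4, h5⟩

section Complete
variable (t : ℕ → T) (s : ℕ → K → List Γ) (N : ℕ)

/-- The word describing a computation by rows with `N` cells. -/
def runWord (j : ℕ) : Letter T K Γ :=
  (t (j / (N + 1)), if j % (N + 1) = 0 then none else
    some fun κ => ((s (j / (N + 1)) κ).reverse[j % (N + 1) - 1]?,
      (s (j / (N + 1) + 1) κ).reverse[j % (N + 1) - 1]?))

/-- The timing of `runWord`. -/
noncomputable def runTime (j : ℕ) : ℝ := 1 + j / (N + 1 : ℕ)

lemma runWord_add (j : ℕ) : runWord t s N (N + 1 + j) =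
    (t (j / (N + 1) + 1), if j % (N + 1) = 0 then none else
    some fun κ => ((s (j / (N + 1) + 1) κ).reverse[j % (N + 1) - 1]?,
      (s (j / (N + 1) + 2) κ).reverse[j % (N + 1) - 1]?)) := by
  simp [runWord, Nat.add_div_left, Nat.add_mod_left]

lemma succ_div_mod (j : ℕ) :
    (j % (N + 1) < N ∧ (j + 1) / (N + 1) = j / (N + 1) ∧ (j + 1) % (N + 1) = j % (N + 1) + 1) ∨
    (j % (N + 1) = N ∧ (j + 1) / (N + 1) = j / (N + 1) + 1 ∧ (j + 1) % (N + 1) = 0) := by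
  have h1 : j % (N + 1) < N + 1 := Nat.mod_lt j (Nat.succ_pos N)
  have h2 := Nat.div_add_mod j (N + 1)
  rcases Nat.lt_succ_iff_lt_or_eq.1 h1 with h | h
  · exact .inl ⟨h, (Nat.div_mod_unique (Nat.succ_pos N)).2 ⟨by linarith, by omega⟩⟩
  · refine .inr ⟨h, (Nat.div_mod_unique (Nat.succ_pos N)).2 ⟨by linarith, by omega⟩⟩

lemma runWord_map (j : ℕ) (κ : K) : (runWord t s N j).2.map (· κ) =
    Act.cells N (fun r => (s (j / (N + 1)) κ).reverse[r]?)
      (fun r => (s (j / (N + 1) + 1) κ).reverse[r]?) (j % (N + 1)) := by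
  have : j % (N + 1) < N + 1 := Nat.mod_lt j (Nat.succ_pos N)
  unfold runWord Act.cells
  split_ifs with h1 h2 h2
  · omega
  · rfl
  · rfl
  · omega

variable {t s N}

lemma timedWord_of_halts [Finite K] {m : ℕ} (hne : M.start ≠ M.exit) (h : M.Halts m) :
    ∃ L w τ, TimedWord M.tiling m L w τ ∧ Matching M.tiling L w τ := by
  obtain ⟨k, s₀, h⟩ := h
  obtain ⟨t, s, ht0, -, htk, -, hstep⟩ := h.exists_run
  obtain ⟨N, hN0, hN⟩ : ∃ N, 0 < N ∧ ∀ i ≤ k, ∀ κ, (s i κ).length ≤ N := by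
    have hfin : (⋃ i ∈ Set.Iic k, Set.range fun κ => (s i κ).length).Finite :=
      (Set.finite_Iic k).biUnion fun i _ => Set.finite_range _
    obtain ⟨B, hB⟩ := hfin.bddAbove
    refine ⟨B + 1, Nat.succ_pos B, fun i hi κ => (hB ?_).trans (Nat.le_succ B)⟩
    simp only [Set.mem_iUnion]
    exact ⟨i, hi, κ, rfl⟩
  have hNR : (0 : ℝ) < (N + 1 : ℕ) := by positivity
  have hidx : ∀ {j}, j < k * (N + 1) → j / (N + 1) < k := fun {j} hj =>
    (Nat.div_lt_iff_lt_mul (Nat.succ_pos N)).2 hj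
  have hmlt : ∀ j, j % (N + 1) < N + 1 := fun j => Nat.mod_lt j (Nat.succ_pos N)
  refine ⟨k * (N + 1), runWord t s N, runTime N, ?_, ?_⟩
  · refine ⟨?_, ?_, fun j hj => ?_, ?_, fun j _ => ?_, fun j _ hc => ?_, fun j hj hc => ?_⟩
    · simp [runWord, ht0, tiling]
    · simp [runWord, htk, tiling]
    · have hk := hidx hj
      obtain ⟨h1, h2, h3, h4⟩ := hstep _ hk
      have hm := hmlt j
      have hcell := fun κ => Act.loc_of_rel (r := j % (N + 1)) _ (h3 κ) (hN _ hk.le κ)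
        (hN _ hk κ) (by omega)
      have hfin : runWord t s N j ≠ M.tiling.last := fun he => h1 (congrArg Prod.fst he)
      have hmap : ∀ κ, (runWord t s N (j + 1)).2.map (· κ) =
          Act.cells N (fun r => (s (j / (N + 1)) κ).reverse[r]?)
            (fun r => (s (j / (N + 1) + 1) κ).reverse[r]?) (j % (N + 1) + 1) := by
        intro κ
        rw [runWord_map]
        rcases succ_div_mod N j with ⟨h5, h6, h7⟩ | ⟨h5, h6, h7⟩
        · rw [h6, h7]
        · rw [h7, h5]; simp [Act.cells]
      refine ⟨?_, hfin, ?_, ?_, fun κ => ?_⟩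
      · rcases succ_div_mod N j with ⟨h5, h6, h7⟩ | ⟨h5, h6, h7⟩
        · simp [runWord, h7]
        · simp [runWord, h5, hN0.ne']
      · rcases succ_div_mod N j with ⟨h5, h6, h7⟩ | ⟨h5, h6, h7⟩
        · simp [runWord, h7]
        · simp [runWord, h6, h2]
      · rcases succ_div_mod N j with ⟨h5, h6, h7⟩ | ⟨h5, h6, h7⟩
        · simp [runWord, h6]
        · simp [runWord, h7]
      · rw [hmap, runWord_map]
        exact hcell κ
    · simp [runTime]
    · simp only [runTime]
      gcongr
      omega
    · have hnone : ∀ j, M.tiling.ctl (runWord t s N j) ↔ j % (N + 1) = 0 := fun j => by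
        simp [tiling, runWord]
      have key : ∀ j, rowClock M.tiling (runWord t s N) (runTime N) (j + 1) =
          ((j % (N + 1) : ℕ) + 1) / (N + 1 : ℕ) := by
        intro j
        induction j with
        | zero =>
          rw [rowClock, if_pos ((hnone 0).2 (Nat.zero_mod _))]
          simp [runTime]
        | succ j ih =>
          have hd : runTime N (j + 1 + 1) - runTime N (j + 1) = 1 / (N + 1 : ℕ) := by
            simp only [runTime]; push_cast; ring
          rw [rowClock, hd]
          split_ifs with hc
          · rw [(hnone _).1 hc]; simp
          · rw [ih]
            rw [hnone] at hc
            rcases succ_div_mod N j with ⟨h5, h6, h7⟩ | ⟨h5, h6, h7⟩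
            · rw [h7]; push_cast; ring
            · exact absurd h7 hc
      rw [hnone] at hc
      cases j with
      | zero => simp [rowClock, runTime]
      | succ j =>
        rw [key]
        rcases succ_div_mod N j with ⟨h5, h6, h7⟩ | ⟨h5, h6, h7⟩
        · omega
        · rw [h5]; push_cast; exact div_self (by positivity)
    · have h1 : t (j / (N + 1)) = M.exit := congrArg Prod.fst hc
      have h2 : j % (N + 1) = 0 := by
        have := congrArg Prod.snd hc
        simpa [runWord, tiling] using this
      obtain ⟨q, rfl⟩ := Nat.dvd_of_mod_eq_zero h2
      rw [Nat.mul_div_cancel_left _ (Nat.succ_pos N)] at h1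
      have hq : q ≤ k := by
        rw [mul_comm] at hj
        exact Nat.le_of_mul_le_mul_right hj (Nat.succ_pos N)
      cases q with
      | zero => exact absurd (ht0.symm.trans h1) hne
      | succ q =>
        rw [← (hstep q hq).2.2.2 h1, runTime, Nat.cast_mul, mul_div_cancel_left₀ _ hNR.ne',
          add_comm]
  · intro x hx1 hxL
    have hL : x ≤ k := by
      rw [runTime, Nat.cast_mul, mul_div_cancel_right₀ _ hNR.ne'] at hxL
      linarith
    have hx0 : 0 ≤ (x - 1) * (N + 1 : ℕ) := mul_nonneg (by linarith) hNR.le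
    obtain ⟨j, hj1, hj2⟩ : ∃ j : ℕ, j ≤ (x - 1) * (N + 1 : ℕ) ∧ (x - 1) * (N + 1 : ℕ) < j + 1 :=
      ⟨⌊(x - 1) * (N + 1 : ℕ)⌋₊, Nat.floor_le hx0, Nat.lt_floor_add_one _⟩
    have hadd : ∀ j, runTime N (N + 1 + j) = runTime N j + 1 := fun j => by
      rw [runTime, runTime, Nat.cast_add, add_div, div_self hNR.ne']; ring
    have hle : ((N + 1 + j : ℕ) : ℝ) ≤ (k * (N + 1) : ℕ) := by
      rw [Nat.cast_add, Nat.cast_mul]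
      nlinarith
    have hlo : runTime N j ≤ x := by
      have := (div_le_iff₀ hNR).2 hj1
      rw [runTime]
      linarith
    have hhi : x < runTime N (j + 1) := by
      have := (lt_div_iff₀ hNR).2 hj2
      rw [runTime, Nat.cast_succ]
      linarith
    rcases hlo.eq_or_lt with rfl | hlo
    · refine ⟨.pt (runWord t s N j), .pt (runWord t s N (N + 1 + j)), ?_,
        ⟨j, ?_, rfl, rfl⟩, ⟨N + 1 + j, ?_, rfl, (hadd j).symm⟩⟩
      · change _ ∧ _
        rw [runWord_add, runWord]
        refine ⟨by simp, fun f g hf hg κ => ?_⟩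
        split_ifs at hf with h0
        simp only [Option.some.injEq] at hf hg
        rw [if_neg h0, Option.some.injEq] at hg
        rw [← hf, ← hg]
      · have : N + 1 + j ≤ k * (N + 1) := by exact_mod_cast hle
        omega
      · exact_mod_cast hle
    · have : N + 1 + j < k * (N + 1) := by
        have h1 : runTime N (N + 1 + j) < 1 + k := by rw [hadd]; linarith
        have h2 := (div_lt_iff₀ hNR).1 (lt_of_add_lt_add_left h1)
        exact_mod_cast h2
      refine ⟨.gap (runWord t s N j), .gap (runWord t s N (N + 1 + j)), trivial,
        ⟨j, by omega, rfl, hlo, hhi⟩, ⟨N + 1 + j, this, rfl, ?_, ?_⟩⟩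
      · rw [hadd]; linarith
      · rw [add_assoc, hadd]; linarith

end Complete

end StackMachine

end HyTime

namespace HyTime

/-! ### The automaton of a tiling system -/

lemma TA.betaOf_eq_some {α : Type} {A : TA α} {v x : ℕ} {k : ClkC α}
    (h : ∃ e ∈ A.beta, e.1 = (v, x)) (hk : ∀ e ∈ A.beta, e.1.2 = x → e.2 = k) :
    A.betaOf v x = some k := by
  obtain ⟨e, he, hvx⟩ := h
  unfold TA.betaOf
  cases hf : A.beta.find? (fun q => q.1.1 == v && q.1.2 == x) with
  | none =>
    have := List.find?_eq_none.1 hf e he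
    simp [hvx] at this
  | some e' =>
    have h1 := List.find?_some hf
    simp only [Bool.and_eq_true, beq_iff_eq] at h1
    rw [Option.map_some, hk e' (List.mem_of_find?_eq_some hf) h1.2]

lemma TA.betaOf_eq_none {α : Type} {A : TA α} {v x : ℕ}
    (h : ∀ e ∈ A.beta, e.1 ≠ (v, x)) : A.betaOf v x = none := by
  unfold TA.betaOf
  rw [Option.map_eq_none_iff, List.find?_eq_none]
  intro e he hc
  simp only [Bool.and_eq_true, beq_iff_eq] at hc
  exact h e he (Prod.ext hc.1 hc.2)

lemma lookup_map_of_injective {σ : Type} {c : σ → ℕ} (hc : Function.Injective c) {β : Type}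
    (f : σ → β) {l : List σ} {s : σ} (hs : s ∈ l) :
    (l.map fun s => (c s, f s)).lookup (c s) = some (f s) := by
  induction l with
  | nil => simp at hs
  | cons a l ih =>
    rw [List.map_cons, List.lookup_cons]
    by_cases ha : s = a
    · subst ha; simp
    · have : (c s == c a) = false := by simpa using fun h => ha (hc h)
      rw [this]
      exact ih ((List.mem_cons.1 hs).resolve_left ha)

namespace St
variable {Λ : Type}

instance [Finite Λ] : Finite (St Λ) :=
  Finite.of_surjective (α := Fin 4 ⊕ Λ ⊕ Λ)
    (Sum.elim ![idle, m1, gm, m2] (Sum.elim pt gap)) (by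
    rintro (_ | _ | _ | _ | a | a)
    exacts [⟨.inl 0, rfl⟩, ⟨.inl 1, rfl⟩, ⟨.inl 2, rfl⟩, ⟨.inl 3, rfl⟩,
      ⟨.inr (.inl a), rfl⟩, ⟨.inr (.inr a), rfl⟩])

/-- States that are visited at a single instant. -/
def IsPoint : St Λ → Prop
  | pt _ | m1 | m2 => True
  | _ => False

variable [Finite Λ]

/-- Codes of states as natural numbers. -/
noncomputable def code (s : St Λ) : ℕ := (Finite.equivFin (St Λ) s : ℕ)

lemma code_injective : Function.Injective (code : St Λ → ℕ) := fun _ _ h =>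
  (Finite.equivFin _).injective (Fin.ext h)

variable (Λ) in
/-- The list of all states. -/
noncomputable def list : List (St Λ) := (Set.toFinite (Set.univ : Set (St Λ))).toFinset.toList

lemma mem_list (s : St Λ) : s ∈ list Λ := by simp [list]

end St

namespace Tiling
variable {Λ : Type} (X : Tiling Λ)

/-- States whose row clock must be one. -/
def IsUnit : St Λ → Prop
  | .pt a => X.ctl a
  | .m2 => True
  | _ => False

/-- The transitions of the automaton. -/
inductive Edge : St Λ → St Λ → Prop
  | start : Edge .idle (.pt X.first)
  | measure : Edge .idle .m1
  | wait : Edge .m1 .gm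
  | close : Edge .gm .m2
  | leave a : Edge (.pt a) (.gap a)
  | next {a b} : X.H a b → Edge (.gap a) (.pt b)

open Classical in
/-- The clocks reset on a transition. Clock `0` is reset when entering a point, and clock `1`
when a row or a measurement begins. -/
noncomputable def rst : St Λ → St Λ → List ℕ
  | .pt a, .gap _ => if X.ctl a then [1] else []
  | _, .pt _ => [0]
  | _, .m1 => [0, 1]
  | _, .m2 => [0]
  | _, _ => []

variable [Finite Λ]

open Classical in
/-- The automaton producing timed words and measurements of unit length. Clock `2` is never
reset, and it dates the marked letter. -/
noncomputable def ta (m : ℕ) : TA ℕ where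
  states := (St.list Λ).map St.code
  init := [(St.idle : St Λ).code]
  props := (St.list Λ).map St.code
  clocks := [0, 1, 2]
  label := (St.list Λ).map fun s => (s.code, [s.code])
  beta := (((St.pt X.mark).code, 2), .atom .eq (m + 1)) ::
    (((St.list Λ).filter (fun s => s.IsPoint)).map (fun s => ((s.code, 0), .atom .eq 0)) ++
     ((St.list Λ).filter (fun s => X.IsUnit s)).map (fun s => ((s.code, 1), .atom .eq 1)))
  edges := (((St.list Λ).product (St.list Λ)).filter fun p => X.Edge p.1 p.2).map
    fun p => (p.1.code, p.2.code, [], X.rst p.1 p.2)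
  final := [(St.m2 : St Λ).code, (St.pt X.last).code]

variable {X} {m : ℕ}

lemma labelOf_ta (s : St Λ) : (X.ta m).labelOf s.code = [s.code] := by
  rw [TA.labelOf, ta, lookup_map_of_injective St.code_injective _ s.mem_list]
  rfl

lemma mem_edges_ta {e : IEdge ℕ} : e ∈ (X.ta m).edges ↔
    ∃ s s', X.Edge s s' ∧ e = (s.code, s'.code, [], X.rst s s') := by
  simp only [ta, List.mem_map, List.mem_filter, decide_eq_true_eq, Prod.exists]
  constructor
  · rintro ⟨s, s', ⟨-, h⟩, rfl⟩
    exact ⟨s, s', h, rfl⟩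
  · rintro ⟨s, s', h, rfl⟩
    exact ⟨s, s', ⟨List.mem_product.2 ⟨s.mem_list, s'.mem_list⟩, h⟩, rfl⟩

lemma mem_beta_ta {e : (ℕ × ℕ) × ClkC ℕ} : e ∈ (X.ta m).beta ↔
    e = (((St.pt X.mark).code, 2), .atom .eq (m + 1)) ∨
    (∃ s : St Λ, s.IsPoint ∧ e = ((s.code, 0), .atom .eq 0)) ∨
    ∃ s : St Λ, X.IsUnit s ∧ e = ((s.code, 1), .atom .eq 1) := by
  simp only [ta, List.mem_cons, List.mem_append, List.mem_map, List.mem_filter,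
    decide_eq_true_eq, St.mem_list, true_and, @eq_comm _ _ e]

lemma holdsOpt_iff {A : TA ℕ} {v x k : ℕ} {y : ℝ} {p : Prop}
    (hp : (∃ e ∈ A.beta, e.1 = (v, x)) ↔ p)
    (hk : ∀ e ∈ A.beta, e.1.2 = x → e.2 = .atom .eq k) :
    ClkC.holdsOpt natR y (A.betaOf v x) ↔ (p → y = k) := by
  by_cases h : ∃ e ∈ A.beta, e.1 = (v, x)
  · rw [TA.betaOf_eq_some h hk]
    simp [ClkC.holdsOpt, ClkC.holds, Cmp.denote, natR, hp.1 h]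
  · rw [TA.betaOf_eq_none (fun e he hc => h ⟨e, he, hc⟩)]
    simp [ClkC.holdsOpt, ← hp, h]

lemma holdsOpt_zero {s : St Λ} {y : ℝ} :
    ClkC.holdsOpt natR y ((X.ta m).betaOf s.code 0) ↔ (s.IsPoint → y = 0) := by
  have := holdsOpt_iff (A := X.ta m) (v := s.code) (x := 0) (k := 0) (y := y) (p := s.IsPoint)
    ?_ ?_
  · simpa using this
  · simp only [mem_beta_ta]
    constructor
    · rintro ⟨e, rfl | ⟨s', h, rfl⟩ | ⟨s', h, rfl⟩, he⟩ <;> simp at he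
      rwa [← St.code_injective he]
    · exact fun h => ⟨_, .inr (.inl ⟨s, h, rfl⟩), rfl⟩
  · simp only [mem_beta_ta]
    rintro e (rfl | ⟨s', h, rfl⟩ | ⟨s', h, rfl⟩) he <;> simp at he ⊢

lemma holdsOpt_one {s : St Λ} {y : ℝ} :
    ClkC.holdsOpt natR y ((X.ta m).betaOf s.code 1) ↔ (X.IsUnit s → y = 1) := by
  have := holdsOpt_iff (A := X.ta m) (v := s.code) (x := 1) (k := 1) (y := y) (p := X.IsUnit s)
    ?_ ?_
  · simpa using this
  · simp only [mem_beta_ta]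
    constructor
    · rintro ⟨e, rfl | ⟨s', h, rfl⟩ | ⟨s', h, rfl⟩, he⟩ <;> simp at he
      rwa [← St.code_injective he]
    · exact fun h => ⟨_, .inr (.inr ⟨s, h, rfl⟩), rfl⟩
  · simp only [mem_beta_ta]
    rintro e (rfl | ⟨s', h, rfl⟩ | ⟨s', h, rfl⟩) he <;> simp at he ⊢

lemma holdsOpt_two {s : St Λ} {y : ℝ} :
    ClkC.holdsOpt natR y ((X.ta m).betaOf s.code 2) ↔ (s = .pt X.mark → y = m + 1) := by
  have := holdsOpt_iff (A := X.ta m) (v := s.code) (x := 2) (k := m + 1) (y := y)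
    (p := s = .pt X.mark) ?_ ?_
  · simpa using this
  · simp only [mem_beta_ta]
    constructor
    · rintro ⟨e, rfl | ⟨s', h, rfl⟩ | ⟨s', h, rfl⟩, he⟩ <;> simp at he
      exact (St.code_injective he).symm
    · rintro rfl
      exact ⟨_, .inl rfl, rfl⟩
  · simp only [mem_beta_ta]
    rintro e (rfl | ⟨s', h, rfl⟩ | ⟨s', h, rfl⟩) he <;> simp at he ⊢

/-! ### Executions as sequences -/

/-- Clock values along a sequence of states and intervals. -/
noncomputable def clk (X : Tiling Λ) (st : ℕ → St Λ) (I : ℕ → TIvl) : ℕ → ℕ → ℝ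
  | 0, _ => 0
  | i + 1, x => if x ∈ X.rst (st i) (st (i + 1)) then 0
      else clk X st I i x + ((I i).hi - (I i).lo)

/-- The sequences of states and intervals of accepting executions. -/
structure Run (X : Tiling Λ) (m n : ℕ) (st : ℕ → St Λ) (I : ℕ → TIvl) : Prop where
  pos : 0 < n
  lo : (I 0).lo = 0
  loC : (I 0).loC = true
  wf : ∀ i < n, (I i).WF
  consecutive : ∀ i, i + 1 < n → (I i).Consecutive (I (i + 1))
  init : st 0 = .idle
  edge : ∀ i, i + 1 < n → X.Edge (st i) (st (i + 1))
  point : ∀ i < n, (st i).IsPoint → ∀ t, (I i).Mem t → X.clk st I i 0 + t - (I i).lo = 0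
  unit : ∀ i < n, X.IsUnit (st i) → ∀ t, (I i).Mem t → X.clk st I i 1 + t - (I i).lo = 1
  mark : ∀ i < n, st i = .pt X.mark → ∀ t, (I i).Mem t → X.clk st I i 2 + t - (I i).lo = m + 1
  final : st (n - 1) = .m2 ∨ st (n - 1) = .pt X.last

/-- The state `s` is observed at time `t` in a run. -/
def RunObs (n : ℕ) (st : ℕ → St Λ) (I : ℕ → TIvl) (t : ℝ) (s : St Λ) : Prop :=
  ∃ i < n, (I i).Mem t ∧ st i = s

/-- The beginning of an execution is described by a run. -/
lemma exists_run_of_isAccExec {ρ : RawExec ℕ} (h : ρ.IsAccExec natR (X.ta m)) :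
    ∃ st I, X.Run m ρ.n st I ∧ ∀ t s, ρ.StateAt t s.code ↔ RunObs ρ.n st I t s := by
  obtain ⟨⟨h1, h2, h3, h4, h5, h6, h7, h8, h9, h10, h11, h12⟩, h13⟩ := h
  have hst : ∀ i < ρ.n, ∃ s : St Λ, ρ.state i = s.code := by
    intro i hi
    cases i with
    | zero => exact ⟨.idle, by simpa [ta] using h9⟩
    | succ i =>
      obtain ⟨s, s', -, he⟩ := mem_edges_ta.1 (h10 i hi)
      exact ⟨s', congrArg (fun e : IEdge ℕ => e.2.1) he⟩
  have : ∀ i, ∃ s : St Λ, i < ρ.n → ρ.state i = s.code := fun i => by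
    by_cases hi : i < ρ.n
    · exact (hst i hi).imp fun s hs _ => hs
    · exact ⟨.idle, fun h => absurd h hi⟩
  choose st hst using this
  have hedge : ∀ i, i + 1 < ρ.n → X.Edge (st i) (st (i + 1)) ∧
      ρ.reset i = X.rst (st i) (st (i + 1)) := by
    intro i hi
    obtain ⟨s, s', hss, he⟩ := mem_edges_ta.1 (h10 i hi)
    have e1 : ρ.state i = s.code := congrArg (fun e : IEdge ℕ => e.1) he
    have e2 : ρ.state (i + 1) = s'.code := congrArg (fun e : IEdge ℕ => e.2.1) he
    have e3 : ρ.reset i = X.rst s s' := congrArg (fun e : IEdge ℕ => e.2.2.2) he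
    rw [hst i (by omega)] at e1
    rw [hst _ hi] at e2
    rw [St.code_injective e1, St.code_injective e2]
    exact ⟨hss, e3⟩
  have hmu : ∀ i < ρ.n, ∀ x, ρ.mu i x = X.clk st ρ.ivl i x := by
    intro i
    induction i with
    | zero => intro _ x; rfl
    | succ i ih =>
      intro hi x
      rw [RawExec.mu, clk, (hedge i hi).2, ih (by omega)]
  refine ⟨st, ρ.ivl, ⟨h1, h5, h6, h7, h8, ?_, fun i hi => (hedge i hi).1, fun i hi hp t ht => ?_,
    fun i hi hp t ht => ?_, fun i hi hp t ht => ?_, ?_⟩, fun t s => ?_⟩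
  · have : ρ.state 0 = (St.idle : St Λ).code := by simpa [ta] using h9
    rw [hst 0 h1] at this
    exact St.code_injective this
  · have := h11 i hi 0 (by simp [ta]) t ht
    rw [hst i hi, holdsOpt_zero, hmu i hi] at this
    exact this hp
  · have := h11 i hi 1 (by simp [ta]) t ht
    rw [hst i hi, holdsOpt_one, hmu i hi] at this
    exact this hp
  · have := h11 i hi 2 (by simp [ta]) t ht
    rw [hst i hi, holdsOpt_two, hmu i hi] at this
    exact this hp
  · rw [hst _ (by omega)] at h13
    simpa [ta, St.code_injective.eq_iff] using h13
  · refine exists_congr fun i => ⟨?_, ?_⟩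
    · rintro ⟨hi, ht, he⟩
      rw [hst i hi] at he
      exact ⟨hi, ht, St.code_injective he⟩
    · rintro ⟨hi, ht, rfl⟩
      exact ⟨hi, ht, hst i hi⟩

/-- Every run comes from an execution. -/
lemma Run.exists_exec {n : ℕ} {st : ℕ → St Λ} {I : ℕ → TIvl} (h : X.Run m n st I) :
    ∃ ρ : RawExec ℕ, ρ.IsAccExec natR (X.ta m) ∧ ∀ t s, ρ.StateAt t s.code ↔ RunObs n st I t s := by
  let ρ : RawExec ℕ := ⟨(List.range n).map fun i => (st i).code, (List.range n).map I,
    List.replicate (n - 1) [], (List.range (n - 1)).map fun i => X.rst (st i) (st (i + 1))⟩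
  have hn : ρ.n = n := by simp [RawExec.n, ρ]
  have hst : ∀ i < n, ρ.state i = (st i).code := fun i hi => by
    simp [RawExec.state, ρ, List.getD_eq_getElem?_getD, hi]
  have hI : ∀ i < n, ρ.ivl i = I i := fun i hi => by
    simp [RawExec.ivl, ρ, List.getD_eq_getElem?_getD, hi]
  have hg : ∀ i, ρ.guard i = [] := fun i => by
    simp only [RawExec.guard, ρ, List.getD_eq_getElem?_getD, List.getElem?_replicate]
    split_ifs <;> rfl
  have hr : ∀ i, i + 1 < n → ρ.reset i = X.rst (st i) (st (i + 1)) := fun i hi => by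
    have : i < n - 1 := by omega
    simp [RawExec.reset, ρ, List.getD_eq_getElem?_getD, this]
  have hmu : ∀ i < n, ∀ x, ρ.mu i x = X.clk st I i x := by
    intro i
    induction i with
    | zero => intro _ x; rfl
    | succ i ih =>
      intro hi x
      rw [RawExec.mu, clk, hr i hi, ih (by omega), hI i (by omega)]
  have h0 := h.pos
  refine ⟨ρ, ⟨⟨hn ▸ h0, ?_, ?_, ?_, ?_, ?_, ?_, ?_, ?_, ?_, ?_, ?_⟩, ?_⟩, fun t s => ?_⟩
  · rw [hn]; simp [ρ]
  · rw [hn]; simp [ρ]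
  · rw [hn]; simp [ρ]
  · rw [hI 0 h0]; exact h.lo
  · rw [hI 0 h0]; exact h.loC
  · intro i hi
    rw [hn] at hi
    rw [hI i hi]
    exact h.wf i hi
  · intro i hi
    rw [hn] at hi
    rw [hI i (by omega), hI _ hi]
    exact h.consecutive i hi
  · rw [hst 0 h0, h.init]; simp [ta]
  · intro i hi
    rw [hn] at hi
    rw [mem_edges_ta]
    refine ⟨_, _, h.edge i hi, ?_⟩
    rw [RawExec.edge, hst i (by omega), hst _ hi, hg, hr i hi]
  · intro i hi x hx t ht
    rw [hn] at hi
    rw [hI i hi] at ht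
    rw [hst i hi, hmu i hi, hI i hi]
    have : x = 0 ∨ x = 1 ∨ x = 2 := by simpa [ta] using hx
    rcases this with rfl | rfl | rfl
    · exact holdsOpt_zero.2 fun hp => h.point i hi hp t ht
    · exact holdsOpt_one.2 fun hp => h.unit i hi hp t ht
    · exact holdsOpt_two.2 fun hp => h.mark i hi hp t ht
  · intro i _ q hq
    rw [hg] at hq
    simp at hq
  · rw [hn, hst _ (by omega)]
    rcases h.final with he | he <;> simp [ta, he]
  · rw [RawExec.StateAt, hn]
    refine exists_congr fun i => ⟨?_, ?_⟩
    · rintro ⟨hi, ht, he⟩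
      rw [hst i hi] at he
      exact ⟨hi, hI i hi ▸ ht, St.code_injective he⟩
    · rintro ⟨hi, ht, rfl⟩
      exact ⟨hi, (hI i hi).symm ▸ ht, hst i hi⟩

end Tiling

end HyTime

namespace HyTime

/-! ### Classification of runs -/

namespace Tiling
variable {Λ : Type} {X : Tiling Λ} {m n : ℕ} {st st' : ℕ → St Λ} {I I' : ℕ → TIvl}

lemma clk_congr : ∀ {i : ℕ}, (∀ k ≤ i, st k = st' k) → (∀ k < i, I k = I' k) → ∀ x,
    X.clk st I i x = X.clk st' I' i x
  | 0, _, _, _ => rfl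
  | i + 1, h1, h2, x => by
    rw [clk, clk, h1 i (by omega), h1 _ le_rfl, h2 i (by omega),
      clk_congr (fun k hk => h1 k (by omega)) (fun k hk => h2 k (by omega))]

lemma Run.congr (h : X.Run m n st I) (h1 : ∀ k < n, st k = st' k) (h2 : ∀ k < n, I k = I' k) :
    X.Run m n st' I' := by
  have h0 := h.pos
  have hc : ∀ i < n, ∀ x, X.clk st' I' i x = X.clk st I i x := fun i hi x =>
    (clk_congr (fun k hk => h1 k (by omega)) (fun k hk => h2 k (by omega)) x).symm
  refine ⟨h0, h2 0 h0 ▸ h.lo, h2 0 h0 ▸ h.loC, fun i hi => h2 i hi ▸ h.wf i hi, fun i hi => ?_,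
    h1 0 h0 ▸ h.init, fun i hi => ?_, fun i hi => ?_, fun i hi => ?_, fun i hi => ?_, ?_⟩
  · rw [← h2 _ hi, ← h2 i (by omega)]
    exact h.consecutive i hi
  · rw [← h1 _ hi, ← h1 i (by omega)]
    exact h.edge i hi
  · rw [← h1 i hi, ← h2 i hi, hc i hi]
    exact h.point i hi
  · rw [← h1 i hi, ← h2 i hi, hc i hi]
    exact h.unit i hi
  · rw [← h1 i hi, ← h2 i hi, hc i hi]
    exact h.mark i hi
  · rw [← h1 _ (by omega)]
    exact h.final

lemma runObs_congr (h1 : ∀ k < n, st k = st' k) (h2 : ∀ k < n, I k = I' k) {t : ℝ} {s : St Λ} :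
    RunObs n st I t s ↔ RunObs n st' I' t s :=
  exists_congr fun i => and_congr_right fun hi => by rw [h1 i hi, h2 i hi]

lemma zero_mem_rst {s s' : St Λ} (h : X.Edge s s') (hs : s'.IsPoint) : 0 ∈ X.rst s s' := by
  cases h <;> first | exact hs.elim | simp [rst]

lemma two_notMem_rst (s s' : St Λ) : 2 ∉ X.rst s s' := by
  cases s <;> cases s' <;> simp [rst]

lemma clk_two (h0 : (I 0).lo = 0) : ∀ {i : ℕ}, (∀ k < i, (I k).Consecutive (I (k + 1))) →
    X.clk st I i 2 = (I i).lo
  | 0, _ => h0.symm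
  | i + 1, h => by
    rw [clk, if_neg (two_notMem_rst _ _), clk_two h0 fun k hk => h k (by omega),
      ← (h i (by omega)).1]
    ring

namespace Run

lemma ivl_point (h : X.Run m n st I) {i : ℕ} (hi : i < n) (hp : (st i).IsPoint) :
    I i = ⟨(I i).lo, (I i).lo, true, true⟩ := by
  obtain _ | i := i
  · rw [h.init] at hp
    exact hp.elim
  have h1 : ∀ t, (I (i + 1)).Mem t → t = (I (i + 1)).lo := by
    intro t ht
    have := h.point _ hi hp t ht
    rw [clk, if_pos (zero_mem_rst (h.edge i hi) hp)] at this
    linarith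
  have h2 := h.wf _ hi
  generalize I (i + 1) = J at h1 h2
  obtain ⟨a, b, c, d⟩ := J
  rcases h2 with h2 | ⟨h2, h3, h4⟩
  · have h3 : a < b := h2
    have : (a + b) / 2 = a := h1 ((a + b) / 2) (by
      constructor <;> simp only <;> split_ifs <;> linarith)
    linarith
  · simp only at h2 h3 h4
    subst h2 h3 h4
    rfl

lemma ivl_zero (h : X.Run m n st I) (hn : 1 < n) (hp : (st 1).IsPoint) :
    I 0 = ⟨0, (I 1).lo, true, false⟩ := by
  have h1 := h.consecutive 0 hn
  have h2 := h.ivl_point hn hp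
  have h3 := h.lo
  have h4 := h.loC
  generalize hJ : (I 1).lo = l at h2
  rw [zero_add, h2] at h1
  generalize I 0 = J at *
  obtain ⟨a, b, c, d⟩ := J
  obtain ⟨h1, h5⟩ := h1
  simp_all

lemma ivl_between (h : X.Run m n st I) {i : ℕ} (hi : i + 2 < n) (hp : (st i).IsPoint)
    (hq : (st (i + 2)).IsPoint) : I (i + 1) = ⟨(I i).lo, (I (i + 2)).lo, false, false⟩ := by
  have h1 := h.consecutive i (by omega)
  have h2 := h.consecutive (i + 1) hi
  have h3 := h.ivl_point (by omega) hp
  have h4 := h.ivl_point hi hq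
  rw [show i + 1 + 1 = i + 2 from rfl] at h2
  generalize (I i).lo = a at *
  generalize (I (i + 2)).lo = b at *
  rw [h3] at h1
  rw [h4] at h2
  generalize I (i + 1) = J at *
  obtain ⟨p, q, c, d⟩ := J
  obtain ⟨h1, h5⟩ := h1
  obtain ⟨h2, h6⟩ := h2
  simp_all

end Run

/-! ### Measurements -/

/-- The states of a measurement. -/
def measSt : ℕ → St Λ
  | 0 => .idle
  | 1 => .m1
  | 2 => .gm
  | _ => .m2

/-- The intervals of a measurement at time `τ`. -/
def measIvl (τ : ℝ) : ℕ → TIvl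
  | 0 => ⟨0, τ, true, false⟩
  | 1 => ⟨τ, τ, true, true⟩
  | 2 => ⟨τ, τ + 1, false, false⟩
  | _ => ⟨τ + 1, τ + 1, true, true⟩

/-- The state `s` is observed at time `t` during a measurement at time `τ`. -/
def MeasObs (τ t : ℝ) : St Λ → Prop
  | .idle => 0 ≤ t ∧ t < τ
  | .m1 => t = τ
  | .gm => τ < t ∧ t < τ + 1
  | .m2 => t = τ + 1
  | _ => False

lemma runObs_meas {τ t : ℝ} {s : St Λ} :
    RunObs 4 measSt (measIvl τ) t s ↔ MeasObs τ t s := by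
  constructor
  · rintro ⟨i, hi, ht, rfl⟩
    interval_cases i
    · simpa [measIvl, TIvl.Mem, measSt, MeasObs] using ht
    · simpa [measIvl, TIvl.Mem, measSt, MeasObs, le_antisymm_iff, and_comm] using ht
    · simpa [measIvl, TIvl.Mem, measSt, MeasObs] using ht
    · simpa [measIvl, TIvl.Mem, measSt, MeasObs, le_antisymm_iff, and_comm] using ht
  · cases s <;> intro ht
    · exact ⟨0, by omega, by simpa [measIvl, TIvl.Mem, MeasObs] using ht, rfl⟩
    · exact ⟨1, by omega, by simp [measIvl, TIvl.Mem, show t = τ from ht], rfl⟩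
    · exact ⟨2, by omega, by simpa [measIvl, TIvl.Mem, MeasObs] using ht, rfl⟩
    · exact ⟨3, by omega, by simp [measIvl, TIvl.Mem, show t = τ + 1 from ht], rfl⟩
    all_goals exact ht.elim

lemma run_meas {τ : ℝ} (hτ : 0 < τ) : X.Run m 4 measSt (measIvl τ) := by
  refine ⟨by omega, rfl, rfl, fun i hi => ?_, fun i hi => ?_, rfl, fun i hi => ?_, fun i hi => ?_,
    fun i hi => ?_, fun i hi => ?_, .inl rfl⟩
  · interval_cases i <;> simp [measIvl, TIvl.WF, hτ]
  · have : i < 3 := by omega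
    interval_cases i <;> simp [measIvl, TIvl.Consecutive]
  · have : i < 3 := by omega
    interval_cases i
    exacts [.measure, .wait, .close]
  · interval_cases i <;> simp [measSt, St.IsPoint, clk, rst, measIvl, TIvl.Mem] <;>
      intros <;> linarith
  · interval_cases i <;> simp [measSt, IsUnit, clk, rst, measIvl, TIvl.Mem] <;>
      intros <;> linarith
  · interval_cases i <;> simp [measSt]

lemma Run.meas (h : X.Run m n st I) (hn : 1 < n) (h1 : st 1 = .m1) :
    ∃ τ : ℝ, 0 < τ ∧ ∀ t s, RunObs n st I t s ↔ MeasObs τ t s := by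
  have hf := h.final
  have hn2 : 2 < n := by
    by_contra hc
    obtain rfl : n = 2 := by omega
    simp [h1] at hf
  have h2 : st 2 = .gm := by
    have := h.edge 1 hn2
    rw [h1] at this
    generalize st (1 + 1) = s at this
    cases this
    rfl
  have hn3 : 3 < n := by
    by_contra hc
    obtain rfl : n = 3 := by omega
    simp [h2] at hf
  have h3 : st 3 = .m2 := by
    have := h.edge 2 hn3
    rw [h2] at this
    generalize st (2 + 1) = s at *
    cases this
    rfl
  obtain rfl : n = 4 := by
    by_contra hc
    have := h.edge 3 (by omega)
    rw [h3] at this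
    generalize st (3 + 1) = s at this
    cases this
  have i0 := h.ivl_zero hn (h1 ▸ trivial)
  have i1 := h.ivl_point hn (h1 ▸ trivial)
  have i2 := h.ivl_between (i := 1) hn3 (h1 ▸ trivial) (h3 ▸ trivial)
  have i3 := h.ivl_point hn3 (h3 ▸ trivial)
  have hw := h.wf 0 (by omega)
  have hu := h.unit 3 hn3 (h3 ▸ trivial) (I 3).lo (by rw [i3]; simp [TIvl.Mem])
  generalize (I 1).lo = a at *
  generalize hb : (I 3).lo = b at *
  simp [clk, h1, h2, h3, i1, i2, rst, h.init] at hu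
  obtain rfl : b = a + 1 := by linarith
  refine ⟨a, ?_, fun t s => ?_⟩
  · rw [i0] at hw
    simpa [TIvl.WF] using hw
  · rw [← runObs_meas]
    refine runObs_congr (fun k hk => ?_) (fun k hk => ?_)
    · interval_cases k
      exacts [h.init, h1, h2, h3]
    · interval_cases k
      exacts [i0, i1, i2, i3]

/-! ### Timed words -/

section Word
variable {L : ℕ} {w : ℕ → Λ} {τ : ℕ → ℝ}

/-- The states along a timed word. -/
def wordSt (w : ℕ → Λ) : ℕ → St Λ
  | 0 => .idle
  | i + 1 => if i % 2 = 0 then .pt (w (i / 2)) else .gap (w (i / 2))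

/-- The intervals along a timed word. -/
def wordIvl (τ : ℕ → ℝ) : ℕ → TIvl
  | 0 => ⟨0, τ 0, true, false⟩
  | i + 1 => if i % 2 = 0 then ⟨τ (i / 2), τ (i / 2), true, true⟩
      else ⟨τ (i / 2), τ (i / 2 + 1), false, false⟩

lemma wordSt_pt (w : ℕ → Λ) (j : ℕ) : wordSt w (2 * j + 1) = .pt (w j) := by
  simp [wordSt]

lemma wordSt_gap (w : ℕ → Λ) (j : ℕ) : wordSt w (2 * j + 2) = .gap (w j) := by
  rw [wordSt, if_neg (by omega), show (2 * j + 1) / 2 = j by omega]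

lemma wordIvl_pt (τ : ℕ → ℝ) (j : ℕ) : wordIvl τ (2 * j + 1) = ⟨τ j, τ j, true, true⟩ := by
  simp [wordIvl]

lemma wordIvl_gap (τ : ℕ → ℝ) (j : ℕ) :
    wordIvl τ (2 * j + 2) = ⟨τ j, τ (j + 1), false, false⟩ := by
  rw [wordIvl, if_neg (by omega), show (2 * j + 1) / 2 = j by omega]

lemma index_cases (i : ℕ) : i = 0 ∨ (∃ j, i = 2 * j + 1) ∨ ∃ j, i = 2 * j + 2 := by
  obtain _ | i := i
  · exact .inl rfl
  rcases Nat.even_or_odd' i with ⟨j, rfl | rfl⟩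
  exacts [.inr (.inl ⟨j, rfl⟩), .inr (.inr ⟨j, rfl⟩)]

lemma runObs_word {t : ℝ} {s : St Λ} :
    RunObs (2 * L + 2) (wordSt w) (wordIvl τ) t s ↔ WordObs L w τ t s := by
  constructor
  · rintro ⟨i, hi, ht, rfl⟩
    rcases index_cases i with rfl | ⟨j, rfl⟩ | ⟨j, rfl⟩
    · simpa [wordIvl, TIvl.Mem, wordSt, WordObs] using ht
    · rw [wordIvl_pt] at ht
      rw [wordSt_pt]
      exact ⟨j, by omega, rfl, le_antisymm (by simpa using ht.2) (by simpa using ht.1)⟩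
    · rw [wordIvl_gap] at ht
      rw [wordSt_gap]
      exact ⟨j, by omega, rfl, by simpa using ht.1, by simpa using ht.2⟩
  · cases s <;> intro ht
    · exact ⟨0, by omega, by simpa [wordIvl, TIvl.Mem, WordObs] using ht, rfl⟩
    case pt a =>
      obtain ⟨j, hj, rfl, rfl⟩ := ht
      exact ⟨2 * j + 1, by omega, by simp [wordIvl_pt, TIvl.Mem], wordSt_pt w j⟩
    case gap a =>
      obtain ⟨j, hj, rfl, ht⟩ := ht
      exact ⟨2 * j + 2, by omega, by simpa [wordIvl_gap, TIvl.Mem] using ht, wordSt_gap w j⟩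
    all_goals exact ht.elim

lemma wordIvl_consecutive (τ : ℕ → ℝ) (i : ℕ) :
    (wordIvl τ i).Consecutive (wordIvl τ (i + 1)) := by
  rcases index_cases i with rfl | ⟨j, rfl⟩ | ⟨j, rfl⟩
  · rw [show 0 + 1 = 2 * 0 + 1 from rfl, wordIvl_pt]
    exact ⟨rfl, rfl⟩
  · rw [wordIvl_pt, wordIvl_gap]
    exact ⟨rfl, rfl⟩
  · rw [wordIvl_gap, show 2 * j + 2 + 1 = 2 * (j + 1) + 1 from rfl, wordIvl_pt]
    exact ⟨rfl, rfl⟩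

lemma clk_wordSt (j : ℕ) :
    X.clk (wordSt w) (wordIvl τ) (2 * j + 1) 1 = rowClock X w τ j := by
  induction j with
  | zero => simp [clk, wordSt, rst, wordIvl, rowClock]
  | succ j ih =>
    rw [show 2 * (j + 1) + 1 = 2 * j + 2 + 1 from rfl, clk, wordSt_gap,
      show 2 * j + 2 + 1 = 2 * (j + 1) + 1 from rfl, wordSt_pt, wordIvl_gap, clk,
      wordSt_pt, wordSt_gap, wordIvl_pt, ih, rowClock]
    by_cases hc : X.ctl (w j) <;> simp [rst, hc]

lemma _root_.HyTime.TimedWord.run (h : TimedWord X m L w τ) :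
    X.Run m (2 * L + 2) (wordSt w) (wordIvl τ) := by
  refine ⟨by omega, rfl, rfl, fun i hi => ?_, fun i _ => wordIvl_consecutive τ i, rfl,
    fun i hi => ?_, fun i hi hp t ht => ?_, fun i hi hp t ht => ?_, fun i hi hp t ht => ?_, ?_⟩
  · rcases index_cases i with rfl | ⟨j, rfl⟩ | ⟨j, rfl⟩
    · exact .inl h.pos
    · rw [wordIvl_pt]
      exact .inr ⟨rfl, rfl, rfl⟩
    · rw [wordIvl_gap]
      exact .inl (h.lt_succ j (by omega))
  · rcases index_cases i with rfl | ⟨j, rfl⟩ | ⟨j, rfl⟩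
    · rw [show 0 + 1 = 2 * 0 + 1 from rfl, wordSt_pt, h.first]
      exact .start
    · rw [wordSt_pt, wordSt_gap]
      exact .leave _
    · rw [wordSt_gap, show 2 * j + 2 + 1 = 2 * (j + 1) + 1 from rfl, wordSt_pt]
      exact .next (h.horiz j (by omega))
  · rcases index_cases i with rfl | ⟨j, rfl⟩ | ⟨j, rfl⟩
    · exact hp.elim
    · rw [wordIvl_pt] at ht ⊢
      have e : t = τ j := le_antisymm (by simpa using ht.2) (by simpa using ht.1)
      rw [clk, if_pos, e, zero_add, sub_self]
      rw [wordSt_pt]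
      cases wordSt w (2 * j) <;> simp [rst]
    · rw [wordSt_gap] at hp
      exact hp.elim
  · rcases index_cases i with rfl | ⟨j, rfl⟩ | ⟨j, rfl⟩
    · exact hp.elim
    · rw [wordSt_pt] at hp
      have := h.row j (by omega) hp
      rw [clk_wordSt, this]
      rw [wordIvl_pt] at ht ⊢
      have e : t = τ j := le_antisymm (by simpa using ht.2) (by simpa using ht.1)
      rw [e, add_sub_cancel_right]
    · rw [wordSt_gap] at hp
      exact hp.elim
  · rcases index_cases i with rfl | ⟨j, rfl⟩ | ⟨j, rfl⟩
    · cases hp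
    · rw [wordSt_pt, St.pt.injEq] at hp
      rw [clk_two rfl fun k _ => wordIvl_consecutive τ k]
      rw [wordIvl_pt] at ht ⊢
      have e : t = τ j := le_antisymm (by simpa using ht.2) (by simpa using ht.1)
      rw [add_sub_cancel_left, e, h.mark j (by omega) hp]
    · rw [wordSt_gap] at hp
      cases hp
  · rw [show 2 * L + 2 - 1 = 2 * L + 1 from rfl, wordSt_pt, h.last]
    exact .inr rfl

lemma Run.timedWord (h : X.Run m (2 * L + 2) (wordSt w) (wordIvl τ)) :
    TimedWord X m L w τ := by
  refine ⟨?_, ?_, fun j hj => ?_, ?_, fun j hj => ?_, fun j hj hc => ?_, fun j hj hc => ?_⟩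
  · have := h.edge 0 (by omega)
    rw [show 0 + 1 = 2 * 0 + 1 from rfl, wordSt_pt] at this
    change X.Edge .idle _ at this
    generalize w 0 = a at this
    cases this
    rfl
  · have := h.final
    rw [show 2 * L + 2 - 1 = 2 * L + 1 from rfl, wordSt_pt] at this
    simpa using this
  · have := h.edge (2 * j + 2) (by omega)
    rw [wordSt_gap, show 2 * j + 2 + 1 = 2 * (j + 1) + 1 from rfl, wordSt_pt] at this
    generalize w j = a at *
    generalize w (j + 1) = b at *
    cases this
    assumption
  · simpa [TIvl.WF, wordIvl] using h.wf 0 (by omega)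
  · have := h.wf (2 * j + 2) (by omega)
    rw [wordIvl_gap] at this
    simpa [TIvl.WF] using this
  · have := h.unit (2 * j + 1) (by omega) (by rw [wordSt_pt]; exact hc) (τ j)
      (by simp [wordIvl_pt, TIvl.Mem])
    rw [clk_wordSt, wordIvl_pt] at this
    simpa using this
  · have := h.mark (2 * j + 1) (by omega) (by rw [wordSt_pt, hc]) (τ j)
      (by simp [wordIvl_pt, TIvl.Mem])
    rw [clk_two rfl fun k _ => wordIvl_consecutive τ k, wordIvl_pt] at this
    simpa using this

lemma Run.word (h : X.Run m n st I) (hn : 1 < n) (h1 : st 1 = .pt X.first) :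
    ∃ L w τ, TimedWord X m L w τ ∧ ∀ t s, RunObs n st I t s ↔ WordObs L w τ t s := by
  have hst : ∀ j, (2 * j + 1 < n → ∃ a, st (2 * j + 1) = .pt a) ∧
      (2 * j + 2 < n → ∃ a, st (2 * j + 1) = .pt a ∧ st (2 * j + 2) = .gap a) := by
    intro j
    have hgap : ∀ j a, 2 * j + 2 < n → st (2 * j + 1) = .pt a → st (2 * j + 2) = .gap a := by
      intro j a hj ha
      have := h.edge _ hj
      rw [ha, show 2 * j + 1 + 1 = 2 * j + 2 from rfl] at this
      generalize st (2 * j + 2) = s at *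
      cases this
      rfl
    induction j with
    | zero => exact ⟨fun _ => ⟨_, h1⟩, fun h2 => ⟨_, h1, hgap 0 _ h2 h1⟩⟩
    | succ j ih =>
      have hpt : 2 * (j + 1) + 1 < n → ∃ a, st (2 * (j + 1) + 1) = .pt a := by
        intro hj
        obtain ⟨a, -, ha⟩ := ih.2 (by omega)
        have := h.edge (2 * j + 2) hj
        rw [ha, show 2 * j + 2 + 1 = 2 * (j + 1) + 1 from rfl] at this
        generalize st (2 * (j + 1) + 1) = s at *
        cases this
        exact ⟨_, rfl⟩
      refine ⟨hpt, fun hj => ?_⟩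
      obtain ⟨a, ha⟩ := hpt (by omega)
      exact ⟨a, ha, hgap _ a hj ha⟩
  obtain ⟨L, rfl⟩ : ∃ L, n = 2 * L + 2 := by
    rcases index_cases n with rfl | ⟨j, rfl⟩ | ⟨j, rfl⟩
    · omega
    · exfalso
      obtain ⟨j, rfl⟩ : ∃ k, j = k + 1 := ⟨j - 1, by omega⟩
      obtain ⟨a, -, ha⟩ := (hst j).2 (by omega)
      have := h.final
      rw [show 2 * (j + 1) + 1 - 1 = 2 * j + 2 from rfl, ha] at this
      simp at this
    · exact ⟨j, rfl⟩
  have : ∀ j, ∃ a, 2 * j + 1 < 2 * L + 2 → st (2 * j + 1) = .pt a := by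
    intro j
    by_cases hj : 2 * j + 1 < 2 * L + 2
    · exact ((hst j).1 hj).imp fun _ ha _ => ha
    · exact ⟨X.first, fun hc => absurd hc hj⟩
  choose w hw using this
  have hpt : ∀ j, 2 * j + 1 < 2 * L + 2 → (st (2 * j + 1)).IsPoint := fun j hj => by
    rw [hw j hj]
    trivial
  have e1 : ∀ i < 2 * L + 2, st i = wordSt w i := by
    intro i hi
    rcases index_cases i with rfl | ⟨j, rfl⟩ | ⟨j, rfl⟩
    · exact h.init
    · rw [wordSt_pt, hw j hi]
    · obtain ⟨a, ha, hb⟩ := (hst j).2 hi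
      rw [hw j (by omega), St.pt.injEq] at ha
      rw [wordSt_gap, hb, ha]
  have e2 : ∀ i < 2 * L + 2, I i = wordIvl (fun j => (I (2 * j + 1)).lo) i := by
    intro i hi
    rcases index_cases i with rfl | ⟨j, rfl⟩ | ⟨j, rfl⟩
    · exact h.ivl_zero hn (hpt 0 hn)
    · rw [wordIvl_pt]
      exact h.ivl_point hi (hpt j hi)
    · rw [wordIvl_gap]
      exact h.ivl_between (by omega) (hpt j (by omega)) (hpt (j + 1) (by omega))
  exact ⟨L, w, _, (h.congr e1 e2).timedWord, fun t s => (runObs_congr e1 e2).trans runObs_word⟩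

end Word

lemma Run.cases (h : X.Run m n st I) :
    (∃ L w τ, TimedWord X m L w τ ∧ ∀ t s, RunObs n st I t s ↔ WordObs L w τ t s) ∨
      ∃ τ : ℝ, 0 < τ ∧ ∀ t s, RunObs n st I t s ↔ MeasObs τ t s := by
  have hn : 1 < n := by
    by_contra hc
    have := h.pos
    obtain rfl : n = 1 := by omega
    have := h.final
    simp [h.init] at this
  have h1 := h.edge 0 hn
  rw [h.init, zero_add] at h1
  generalize hs : st 1 = s at h1
  cases h1
  · exact .inl (h.word hn hs)
  · exact .inr (h.meas hn hs)

end Tiling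

end HyTime

namespace HyTime

/-! ### The formula -/

namespace HF

/-- The formula `F φ`. -/
def ev (φ : HF ℕ) : HF ℕ := .fut ⟨0, none, false, false⟩ φ

lemma sat_ev {A : TA ℕ} {φ : HF ℕ} {E : ℕ → RawExec ℕ} {t : ℝ} {d : Option ℕ} :
    HSat natR A none φ.ev E t d ↔ ∃ t', t < t' ∧ HSat natR A none φ E t' d := by
  simp [ev, HSat, inBd, FIvl.Mem, natR]

lemma sat_foldr {A : TA ℕ} {ψ : HF ℕ} {E : ℕ → RawExec ℕ} {t : ℝ} {d : Option ℕ}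
    (l : List (HF ℕ)) : HSat natR A none (l.foldr .disj ψ) E t d ↔
      (∃ φ ∈ l, HSat natR A none φ E t d) ∨ HSat natR A none ψ E t d := by
  induction l with
  | nil => simp
  | cons φ l ih => simp [HSat, ih, or_assoc]

/-- Quantifier-free formulas on the path variables `0` and `1`, with nonsingular intervals. -/
def Plain (φ : HF ℕ) : Prop := φ.QFree ∧ φ.NonSing ∧ φ.free ⊆ {0, 1}

lemma plain_pos {p π : ℕ} (h : π ∈ ({0, 1} : Finset ℕ)) : (HF.pos p π : HF ℕ).Plain :=
  ⟨trivial, trivial, Finset.singleton_subset_iff.2 h⟩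

lemma Plain.disj {a b : HF ℕ} (ha : a.Plain) (hb : b.Plain) : (a.disj b).Plain :=
  ⟨⟨ha.1, hb.1⟩, ⟨ha.2.1, hb.2.1⟩, Finset.union_subset ha.2.2 hb.2.2⟩

lemma Plain.conj {a b : HF ℕ} (ha : a.Plain) (hb : b.Plain) : (a.conj b).Plain :=
  ⟨⟨ha.1, hb.1⟩, ⟨ha.2.1, hb.2.1⟩, Finset.union_subset ha.2.2 hb.2.2⟩

lemma Plain.ev {a : HF ℕ} (ha : a.Plain) : a.ev.Plain :=
  ⟨ha.1, ⟨fun h => by simpa using h.1, ha.2.1⟩, ha.2.2⟩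

lemma plain_foldr {ψ : HF ℕ} (hψ : ψ.Plain) :
    ∀ {l : List (HF ℕ)}, (∀ φ ∈ l, φ.Plain) → (l.foldr .disj ψ).Plain
  | [], _ => hψ
  | φ :: l, h => (h φ (by simp)).disj (plain_foldr hψ fun χ hχ => h χ (by simp [hχ]))

end HF

namespace Tiling

section Fits
variable {Λ : Type} {X : Tiling Λ} {m : ℕ}

/-- The meaning of the formula on observations. -/
def Fits (X : Tiling Λ) (O P : ℝ → St Λ → Prop) : Prop :=
  (∃ t, 0 < t ∧ P t (.pt X.first)) ∨
  (∃ t, 0 < t ∧ O t (.pt X.last) ∧ ∃ t', t < t' ∧ P t' .m2) ∨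
  (∃ s s', X.Match s s' ∧ ∃ t, 0 < t ∧ P t .m1 ∧ O t s ∧ ∃ t', t < t' ∧ P t' .m2 ∧ O t' s') ∨
  ∃ t, 0 < t ∧ P t .m1 ∧ O t .idle

lemma fits_word {L L' : ℕ} {w w' : ℕ → Λ} {τ τ' : ℕ → ℝ} (h' : TimedWord X m L' w' τ') :
    X.Fits (WordObs L w τ) (WordObs L' w' τ') :=
  .inl ⟨τ' 0, h'.pos, 0, Nat.zero_le _, h'.first, rfl⟩

lemma fits_meas {L : ℕ} {w : ℕ → Λ} {τ : ℕ → ℝ} (h : TimedWord X m L w τ)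
    (hm : Matching X L w τ) {r : ℝ} (hr : 0 < r) : X.Fits (WordObs L w τ) (MeasObs r) := by
  by_cases h1 : r < 1
  · exact .inr (.inr (.inr ⟨r, hr, rfl, hr.le, h.zero ▸ h1⟩))
  by_cases h2 : r + 1 ≤ τ L
  · obtain ⟨s, s', hs, ho, ho'⟩ := hm r (not_lt.1 h1) h2
    exact .inr (.inr (.inl ⟨s, s', hs, r, hr, rfl, ho, r + 1, by linarith, rfl, ho'⟩))
  · exact .inr (.inl ⟨τ L, h.pos.trans_le (h.le (Nat.zero_le _) le_rfl),
      ⟨L, le_rfl, h.last, rfl⟩, r + 1, not_le.1 h2, rfl⟩)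

lemma matching_of_fits {L : ℕ} {w : ℕ → Λ} {τ : ℕ → ℝ} (h : TimedWord X m L w τ)
    (hf : ∀ r, 0 < r → X.Fits (WordObs L w τ) (MeasObs r)) : Matching X L w τ := by
  intro r hr hr'
  rcases hf r (by linarith) with ⟨t, -, ht⟩ | ⟨t, -, ⟨j, hj, hj', rfl⟩, t', ht', rfl⟩ |
    ⟨s, s', hs, t, -, rfl, ho, t', -, rfl, ho'⟩ | ⟨t, -, rfl, -, ht⟩
  · exact ht.elim
  · exfalso
    obtain rfl | hj := hj.eq_or_lt
    · linarith
    · have := h.horiz j hj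
      rw [hj'] at this
      exact X.not_H_last _ this
  · exact ⟨s, s', hs, ho, ho'⟩
  · rw [h.zero] at ht
    exact absurd ht (not_lt.2 hr)

end Fits

variable {Λ : Type} [Finite Λ] (X : Tiling Λ)

/-- The state of the execution `π` is `s`. -/
noncomputable def is (s : St Λ) (π : ℕ) : HF ℕ := .pos s.code π

/-- The measurement sees `s` and, one time unit later, `s'`. -/
noncomputable def pairFormula (s s' : St Λ) : HF ℕ :=
  ((is (.m1 : St Λ) 1).conj ((is s 0).conj ((is (.m2 : St Λ) 1).conj (is s' 0)).ev)).ev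

open Classical in
/-- The execution `1` is not a measurement, or it fits the execution `0`. -/
noncomputable def fitFormula : HF ℕ :=
  (is (.pt X.first) 1).ev.disj
    (((is (.pt X.last) 0).conj (is (.m2 : St Λ) 1).ev).ev.disj
      (((((St.list Λ).product (St.list Λ)).filter fun p => X.Match p.1 p.2).map
        fun p => pairFormula p.1 p.2).foldr .disj
          ((is (.m1 : St Λ) 1).conj (is (.idle : St Λ) 0)).ev))

/-- Some timed word fits all measurements. -/
noncomputable def formula : HF ℕ :=
  .ex 0 (.all 1 ((is (.pt X.first) 0).ev.conj X.fitFormula))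

lemma plain_body : ((is (.pt X.first) 0).ev.conj X.fitFormula).Plain := by
  have h0 : ∀ s : St Λ, (is s 0).Plain := fun s => HF.plain_pos (by simp)
  have h1 : ∀ s : St Λ, (is s 1).Plain := fun s => HF.plain_pos (by simp)
  refine (h0 _).ev.conj ((h1 _).ev.disj (((h0 _).conj (h1 _).ev).ev.disj
    (HF.plain_foldr ((h1 _).conj (h0 _)).ev fun φ hφ => ?_)))
  obtain ⟨p, -, rfl⟩ := List.mem_map.1 hφ
  exact ((h1 _).conj ((h0 _).conj ((h1 _).conj (h0 _)).ev)).ev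

lemma sentence_formula : X.formula.Sentence := by
  have h := X.plain_body.2.2
  rw [HF.Sentence, formula, HF.free, HF.free]
  ext i
  simp only [Finset.mem_erase, Finset.notMem_empty, iff_false]
  rintro ⟨hi0, hi1, hi⟩
  have := h hi
  simp [hi0, hi1] at this

lemma hyperMITL_formula : X.formula.HyperMITL := ⟨X.plain_body.1, X.plain_body.2.1⟩

variable {X} {m : ℕ}

lemma mem_labelOf_ta {s : St Λ} {v : ℕ} : s.code ∈ (X.ta m).labelOf v ↔ v = s.code := by
  by_cases hv : ∃ s' : St Λ, v = s'.code
  · obtain ⟨s', rfl⟩ := hv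
    rw [labelOf_ta, List.mem_singleton, eq_comm]
  · have : (X.ta m).labelOf v = [] := by
      rw [TA.labelOf, List.lookup_eq_none_iff.2]
      · rfl
      · rintro p hp
        obtain ⟨s', -, rfl⟩ := List.mem_map.1 hp
        simpa using fun h => hv ⟨s', h⟩
    rw [this]
    simpa using fun h => hv ⟨s, h⟩

lemma sat_is {s : St Λ} {π : ℕ} {E : ℕ → RawExec ℕ} {t : ℝ} {d : Option ℕ} :
    HSat natR (X.ta m) none (is s π) E t d ↔ (E π).StateAt t s.code := by
  simp only [is, HSat, mem_labelOf_ta]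
  constructor
  · rintro ⟨-, v, h, rfl⟩
    exact h
  · intro h
    exact ⟨h.imp fun i hi => ⟨hi.1, hi.2.1⟩, _, h, rfl⟩

lemma sat_fitFormula {E : ℕ → RawExec ℕ} {d : Option ℕ} {O P : ℝ → St Λ → Prop}
    (hO : ∀ t s, (E 0).StateAt t s.code ↔ O t s) (hP : ∀ t s, (E 1).StateAt t s.code ↔ P t s) :
    HSat natR (X.ta m) none X.fitFormula E 0 d ↔ X.Fits O P := by
  have hpair : ∀ s s' : St Λ, HSat natR (X.ta m) none (pairFormula s s') E 0 d ↔
      ∃ t, 0 < t ∧ P t .m1 ∧ O t s ∧ ∃ t', t < t' ∧ P t' .m2 ∧ O t' s' := fun s s' => by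
    simp only [pairFormula, HSat, HF.sat_ev, sat_is, hO, hP]
  simp only [fitFormula, HSat, HF.sat_foldr, HF.sat_ev, sat_is, hO, hP, Fits, ← hpair]
  refine or_congr Iff.rfl (or_congr Iff.rfl (or_congr ⟨?_, ?_⟩ Iff.rfl))
  · rintro ⟨φ, hφ, hs⟩
    obtain ⟨p, hp, rfl⟩ := List.mem_map.1 hφ
    exact ⟨p.1, p.2, by simpa using (List.mem_filter.1 hp).2, hs⟩
  · rintro ⟨s, s', hm, hs⟩
    exact ⟨_, List.mem_map.2 ⟨(s, s'), List.mem_filter.2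
      ⟨List.mem_product.2 ⟨s.mem_list, s'.mem_list⟩, by simpa using hm⟩, rfl⟩, hs⟩

lemma mem_zero_ivl {ρ : RawExec ℕ} (h : ρ.IsAccExec natR (X.ta m)) : (ρ.ivl 0).Mem 0 := by
  obtain ⟨⟨h1, -, -, -, h5, h6, h7, -⟩, -⟩ := h
  have h7 := h7 0 h1
  generalize ρ.ivl 0 = J at *
  obtain ⟨a, b, c, d⟩ := J
  simp only at h5 h6
  subst h5 h6
  rcases h7 with h7 | ⟨h7, -, h8⟩
  · have : (0 : ℝ) < b := h7
    cases d <;> simp [TIvl.Mem, this, this.le]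
  · simp only at h7 h8
    simp [TIvl.Mem, ← h7, h8]

lemma prefixUpTo_zero {ρ : RawExec ℕ} (h : ρ.IsAccExec natR (X.ta m)) :
    ρ.prefixUpTo 0 = ⟨[(St.idle : St Λ).code], [⟨0, 0, true, true⟩], [], []⟩ := by
  have hm := mem_zero_ivl h
  obtain ⟨⟨h1, h2, -, -, h5, h6, -, -, h9, -⟩, -⟩ := h
  have hs : ρ.state 0 = (St.idle : St Λ).code := by simpa [ta] using h9
  have hi : ρ.idxAt 0 = 0 := by
    rw [RawExec.n] at h1 h2
    cases hJ : ρ.ivls with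
    | nil => rw [hJ] at h2; simp at h2; omega
    | cons J l =>
      have : ρ.ivl 0 = J := by simp [RawExec.ivl, hJ]
      rw [this] at hm
      simp [RawExec.idxAt, hJ, List.findIdx_cons, hm]
  have ht : ρ.states.take 1 = [(St.idle : St Λ).code] := by
    rw [RawExec.n] at h1
    rw [RawExec.state] at hs
    cases hJ : ρ.states with
    | nil => simp [hJ] at h1
    | cons v l => simpa [hJ] using hs
  simp [RawExec.prefixUpTo, hi, h5, h6, ht]

/-- The formula expresses the existence of a timed word that matches itself one unit later. -/
theorem sat_formula : HSat natR (X.ta m) none X.formula (fun _ => default) 0 none ↔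
    ∃ L w τ, TimedWord X m L w τ ∧ Matching X L w τ := by
  simp only [formula, HSat, HF.sat_ev, sat_is]
  constructor
  · rintro ⟨ρ, ⟨hρ, -⟩, -, hall⟩
    have key : ∀ u : RawExec ℕ, u.IsAccExec natR (X.ta m) → _ := fun u hu => hall u ⟨hu, by simp⟩
      (.inr ⟨0, rfl, ⟨0, hρ.1.1, mem_zero_ivl hρ⟩,
        (prefixUpTo_zero hu).trans (prefixUpTo_zero hρ).symm⟩)
    obtain ⟨st, I, hrun, hobs⟩ := exists_run_of_isAccExec hρ
    rcases hrun.cases with ⟨L, w, τ, hw, hw'⟩ | ⟨r, -, hr'⟩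
    · refine ⟨L, w, τ, hw, matching_of_fits hw fun r hr => ?_⟩
      obtain ⟨u, hu, hu'⟩ := (run_meas (X := X) (m := m) hr).exists_exec
      exact (sat_fitFormula (fun t s => by simpa using (hobs t s).trans (hw' t s))
        (fun t s => by simpa using (hu' t s).trans runObs_meas)).1 (key u hu).2
    · exfalso
      obtain ⟨t, -, ht⟩ := (key ρ hρ).1
      have := (hr' _ _).1 ((hobs _ _).1 (by simpa using ht))
      exact this
  · rintro ⟨L, w, τ, hw, hm⟩
    obtain ⟨ρ, hρ, hρ'⟩ := hw.run.exists_exec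
    replace hρ' := fun t s => (hρ' t s).trans runObs_word
    refine ⟨ρ, ⟨hρ, by simp⟩, .inl ⟨trivial, trivial⟩, fun u hu _ => ⟨⟨τ 0, hw.pos, ?_⟩, ?_⟩⟩
    · have : WordObs L w τ (τ 0) (.pt X.first) := ⟨0, Nat.zero_le _, hw.first, rfl⟩
      simpa using (hρ' _ _).2 this
    · obtain ⟨st, I, hrun, hobs⟩ := exists_run_of_isAccExec hu.1
      rcases hrun.cases with ⟨L', w', τ', hw', hu'⟩ | ⟨r, hr, hu'⟩
      · exact (sat_fitFormula (fun t s => by simpa using hρ' t s)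
          (fun t s => by simpa using (hobs t s).trans (hu' t s))).2 (fits_word hw')
      · exact (sat_fitFormula (fun t s => by simpa using hρ' t s)
          (fun t s => by simpa using (hobs t s).trans (hu' t s))).2 (fits_meas hw hm hr)

lemma primrec_encTA : Primrec fun m => encTA (X.ta m) := by
  simp only [encTA, ta, encList, encClkC]
  have hp : ∀ {f g : ℕ → ℕ}, Primrec f → Primrec g → Primrec fun m => Nat.pair (f m) (g m) :=
    fun hf hg => Primrec₂.natPair.comp hf hg
  have hc : ∀ a : ℕ, Primrec fun _ : ℕ => a := fun a => Primrec.const a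
  exact hp (hc _) <| hp (hc _) <| hp (hc _) <| hp (hc _) <| hp (hc _) <|
    hp (Primrec.succ.comp <| hp (hp (hc _) <| hp (hc _) <| hp (hc _) Primrec.succ) (hc _)) <|
    hc _

end Tiling

end HyTime

namespace HyTime

namespace Compile

lemma start_ne_exit (c : Turing.ToPartrec.Code) : (machine c).start ≠ (machine c).exit := fun h => by
  have := congrArg (fun t : Tr c => t.1.1) h
  cases this

instance : Finite Turing.PartrecToTM2.Γ' := Fintype.finite inferInstance

end Compile

/-- No algorithm decides the validity of HyperMITL sentences on timed automata. -/
theorem not_exists_decision_hyperMITL :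
    ¬ ∃ dec : ℕ → Bool, Computable dec ∧
      ∀ (A : TA ℕ) (φ : HF ℕ), φ.Sentence → φ.HyperMITL →
        (dec (Nat.pair (encTA A) (encHF φ)) = true ↔
          HSat natR A none φ (fun _ => default) 0 none) := by
  rintro ⟨dec, hdec, h⟩
  have hf : Partrec fun m : ℕ => (Denumerable.ofNat Nat.Partrec.Code m).eval 0 :=
    Nat.Partrec.Code.eval_part.comp (Computable.ofNat _) (Computable.const 0)
  obtain ⟨c, hc⟩ := Compile.exists_machine hf
  let X := (Compile.machine c).tiling
  have hred : ∀ m : ℕ, dec (Nat.pair (encTA (X.ta (m + 3))) (encHF X.formula)) = true ↔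
      ((Denumerable.ofNat Nat.Partrec.Code m).eval 0).Dom := by
    intro m
    rw [h _ _ X.sentence_formula X.hyperMITL_formula, Tiling.sat_formula, ← hc]
    exact ⟨fun ⟨L, w, τ, h1, h2⟩ => StackMachine.halts_of_timedWord (fun _ => rfl) h1 h2,
      StackMachine.timedWord_of_halts (Compile.start_ne_exit c)⟩
  have hcomp : Computable fun p : Nat.Partrec.Code =>
      dec (Nat.pair (encTA (X.ta (Encodable.encode p + 3))) (encHF X.formula)) := by
    refine hdec.comp (Primrec.to_comp (Primrec₂.natPair.comp ?_ (Primrec.const _)))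
    exact X.primrec_encTA.comp (Primrec.nat_add.comp Primrec.encode (Primrec.const 3))
  refine ComputablePred.halting_problem 0 (ComputablePred.computable_iff.2 ⟨_, hcomp, ?_⟩)
  funext p
  exact propext ((by simpa using (hred (Encodable.encode p)).symm))

end HyTime

namespace HyTime

/-- The general (unbounded) verification problem for HCMTL* in the
interval-based semantics is undecidable: no computable function decides, on the code of
a pair `(A, φ)` of a timed automaton and an HCMTL* sentence, whether `{}, 0, ε ⊨_A φ`.
Moreover, undecidability already holds when `φ` is restricted to the HyperMITL fragment. -/
theorem general_interval_verification_undecidable :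
    (¬ ∃ dec : ℕ → Bool, Computable dec ∧
      ∀ (A : TA ℕ) (φ : HF ℕ), φ.Sentence →
        (dec (Nat.pair (encTA A) (encHF φ)) = true ↔
          HSat natR A none φ (fun _ => default) 0 none)) ∧
    (¬ ∃ dec : ℕ → Bool, Computable dec ∧
      ∀ (A : TA ℕ) (φ : HF ℕ), φ.Sentence → φ.HyperMITL →
        (dec (Nat.pair (encTA A) (encHF φ)) = true ↔
          HSat natR A none φ (fun _ => default) 0 none)) := by
  refine ⟨fun ⟨dec, hdec, h⟩ => ?_, not_exists_decision_hyperMITL⟩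
  exact not_exists_decision_hyperMITL ⟨dec, hdec, fun A φ hφ _ => h A φ hφ⟩

end HyTime
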